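/- Let ρ be a probability density on ℝ with mean zero, unit variance, finite Fisher information I(ρ) < ∞, and finite fourth moment ∫ x⁴ ρ(x) dx < ∞. For N = 2ⁿ let ρ_N denote the density of N^{-1/2}(X₁ + ⋯ + X_N) where the X_j are i.i.d. with density ρ. Then there is a constant c (depending on ρ) such that D(ρ_N) ≤ c/N for all n; in particular ρ_N converges to the standard Gaussian in relative entropy, and in L¹, at the optimal rate N^{-1/2}. -/

import Mathlib

open MeasureTheory Real Set

noncomputable section

/-- The standard Gaussian density on ℝ. -/
def gaussPDF (x : ℝ) : ℝ := (Real.sqrt (2 * Real.pi))⁻¹ * Real.exp (-x ^ 2 / 2)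

/-- Convolution of two densities on ℝ. -/
def convDens (f g : ℝ → ℝ) (x : ℝ) : ℝ := ∫ y, f (x - y) * g y

/-- `iterConv ρ n` is the `(n+1)`-fold convolution of `ρ` with itself. -/
def iterConv (ρ : ℝ → ℝ) : ℕ → ℝ → ℝ
  | 0 => ρ
  | n + 1 => convDens (iterConv ρ n) ρ

/-- `rescaledConv ρ n` is the density of `n^{-1/2}(X₁ + ⋯ + Xₙ)` for i.i.d. `Xⱼ`
with density `ρ`, i.e. `x ↦ √n (ρ∗⋯∗ρ)(√n x)` with the `n`-fold convolution. -/
def rescaledConv (ρ : ℝ → ℝ) (n : ℕ) (x : ℝ) : ℝ :=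
  Real.sqrt n * iterConv ρ (n - 1) (Real.sqrt n * x)

/-- The density of `(X+Y)/√2` for independent `X`, `Y` with densities `ρ`, `η`. -/
def rescaledConvPair (ρ η : ℝ → ℝ) (x : ℝ) : ℝ :=
  Real.sqrt 2 * convDens ρ η (Real.sqrt 2 * x)

/-- The rescaled self-convolution `ρ ⊛ ρ`. -/
def selfConv (ρ : ℝ → ℝ) : ℝ → ℝ := rescaledConvPair ρ ρ

/-- Entropy `S(ρ) = -∫ ρ ln ρ`. -/
def entropy (ρ : ℝ → ℝ) : ℝ := -∫ x, ρ x * Real.log (ρ x)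

/-- Relative entropy `D(ρ) = ∫ ρ ln (ρ/g)` with respect to the standard Gaussian. -/
def relEntropy (ρ : ℝ → ℝ) : ℝ := ∫ x, ρ x * Real.log (ρ x / gaussPDF x)

/-- Fisher information `I(ρ) = 4 ∫ |(√ρ)'|²`. -/
def fisherInfo (ρ : ℝ → ℝ) : ℝ := 4 * ∫ x, (deriv (fun y => Real.sqrt (ρ y)) x) ^ 2

/-- Relative Fisher information `J(ρ) = 4 ∫ |((d/dx) + x/2)√ρ|²`. -/
def relFisher (ρ : ℝ → ℝ) : ℝ :=
  4 * ∫ x, (deriv (fun y => Real.sqrt (ρ y)) x + (x / 2) * Real.sqrt (ρ x)) ^ 2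

/-- The ψ-function `ψ_ρ(R) = ∫_{|x| ≥ R} x² ρ(x) dx`. -/
def psiFun (ρ : ℝ → ℝ) (R : ℝ) : ℝ := ∫ x in {x : ℝ | R ≤ |x|}, x ^ 2 * ρ x

/-- A nonnegative function is log-concave if
`F((1-t)x + ty) ≥ F(x)^{1-t} F(y)^{t}` for `t ∈ [0,1]`. -/
def LogConcaveFun (F : ℝ → ℝ) : Prop :=
  (∀ x, 0 ≤ F x) ∧
  ∀ x y t : ℝ, 0 ≤ t → t ≤ 1 → F x ^ (1 - t) * F y ^ t ≤ F ((1 - t) * x + t * y)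



/-- Laplace transform. -/
def lap (f : ℝ → ℝ) (z : ℂ) : ℂ := ∫ x, (f x : ℂ) * Complex.exp (z * x)

lemma conv_key {E : Type*} [NormedAddCommGroup E] [NormedSpace ℝ E] [CompleteSpace E]
    {f g : ℝ → ℝ} {h : ℝ → E}
    (H : Integrable (fun p : ℝ × ℝ => (f p.1 * g p.2) • h (p.1 + p.2)) (volume.prod volume)) :
    Integrable (fun x => convDens f g x • h x) ∧
    ∫ x, convDens f g x • h x
      = ∫ p : ℝ × ℝ, (f p.1 * g p.2) • h (p.1 + p.2) ∂(volume.prod volume) := by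
  have mp := measurePreserving_sub_prod (volume : Measure ℝ) (volume : Measure ℝ)
  have emb : MeasurableEmbedding (fun z : ℝ × ℝ => (z.1 - z.2, z.2)) :=
    (MeasurableEquiv.measurableEmbedding
      { toFun := fun z : ℝ × ℝ => (z.1 - z.2, z.2)
        invFun := fun z : ℝ × ℝ => (z.1 + z.2, z.2)
        left_inv := fun z => by simp
        right_inv := fun z => by simp
        measurable_toFun := by simp only [Equiv.coe_fn_mk]; fun_prop
        measurable_invFun := by simp only [Equiv.coe_fn_symm_mk]; fun_prop })
  have H2 := mp.integrable_comp_of_integrable H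
  have e : ((fun p : ℝ × ℝ => (f p.1 * g p.2) • h (p.1 + p.2)) ∘ fun z : ℝ × ℝ => (z.1 - z.2, z.2))
      = fun p : ℝ × ℝ => (f (p.1 - p.2) * g p.2) • h p.1 := by
    ext p; simp
  rw [e] at H2
  have e2 : ∀ x, ∫ y, (f (x - y) * g y) • h x = convDens f g x • h x := by
    intro x
    rw [convDens, integral_smul_const]
  constructor
  · have := H2.integral_prod_left
    simpa only [e2] using this
  · rw [← mp.integral_comp emb]
    have e3 : (fun z : ℝ × ℝ => (f (z.1 - z.2, z.2).1 * g (z.1 - z.2, z.2).2) •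
        h ((z.1 - z.2, z.2).1 + (z.1 - z.2, z.2).2)) =
        fun p : ℝ × ℝ => (f (p.1 - p.2) * g p.2) • h p.1 := by
      ext p; simp
    rw [e3, integral_prod _ H2]
    simp only [e2]

lemma convDens_measurable {f g : ℝ → ℝ} (hf : Measurable f) (hg : Measurable g) :
    Measurable (convDens f g) := by
  have : StronglyMeasurable (Function.uncurry fun x y => f (x - y) * g y) :=
    Measurable.stronglyMeasurable (by simp only [Function.uncurry_def]; fun_prop)
  exact this.integral_prod_right.measurable

lemma iterConv_measurable {f : ℝ → ℝ} (hf : Measurable f) (k : ℕ) : Measurable (iterConv f k) := by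
  induction k with
  | zero => exact hf
  | succ k ih => exact convDens_measurable ih hf

lemma iterConv_nonneg {f : ℝ → ℝ} (hf : ∀ x, 0 ≤ f x) (k : ℕ) : ∀ x, 0 ≤ iterConv f k x := by
  induction k with
  | zero => exact hf
  | succ k ih => exact fun x => integral_nonneg fun y => mul_nonneg (ih _) (hf _)

lemma conv_integrand {F f : ℝ → ℝ} {M : ℝ} (hFm : Measurable F) (hF0 : ∀ x, 0 ≤ F x)
    (hFM : ∀ x, F x ≤ M) (hfi : Integrable f) (x : ℝ) :
    Integrable fun y => F (x - y) * f y := by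
  refine hfi.bdd_mul (c := M) (hFm.comp (measurable_const.sub measurable_id)).aestronglyMeasurable (Filter.Eventually.of_forall fun y => ?_)
  rw [Real.norm_of_nonneg (hF0 _)]; exact hFM _

lemma iterConv_le {f : ℝ → ℝ} {M : ℝ} (hfm : Measurable f) (hf : ∀ x, 0 ≤ f x) (hM : ∀ x, f x ≤ M)
    (hfi : Integrable f) (h1 : ∫ x, f x ≤ 1) (k : ℕ) : ∀ x, iterConv f k x ≤ M := by
  have hM0 : 0 ≤ M := (hf 0).trans (hM 0)
  induction k with
  | zero => exact hM
  | succ k ih =>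
    intro x
    calc ∫ y, iterConv f k (x - y) * f y ≤ ∫ y, M * f y := by
          refine integral_mono (conv_integrand (iterConv_measurable hfm k) (iterConv_nonneg hf k) ih
            hfi x) (hfi.const_mul M) fun y => mul_le_mul_of_nonneg_right (ih _) (hf _)
      _ = M * ∫ y, f y := integral_const_mul _ _
      _ ≤ M := by nlinarith

lemma iterConv_mono {f ρ : ℝ → ℝ} {M : ℝ} (hfm : Measurable f) (hf : ∀ x, 0 ≤ f x)
    (hρm : Measurable ρ) (hfρ : ∀ x, f x ≤ ρ x) (hM : ∀ x, ρ x ≤ M)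
    (hρi : Integrable ρ) (h1 : ∫ x, ρ x ≤ 1) (k : ℕ) : ∀ x, iterConv f k x ≤ iterConv ρ k x := by
  have hρ : ∀ x, 0 ≤ ρ x := fun x => (hf x).trans (hfρ x)
  have hfi : Integrable f := hρi.mono' hfm.aestronglyMeasurable
    (Filter.Eventually.of_forall fun x => by rw [Real.norm_of_nonneg (hf x)]; exact hfρ x)
  have h1' : ∫ x, f x ≤ 1 := (integral_mono hfi hρi hfρ).trans h1
  induction k with
  | zero => exact hfρ
  | succ k ih =>
    intro x
    exact integral_mono (conv_integrand (iterConv_measurable hfm k) (iterConv_nonneg hf k)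
      (iterConv_le hfm hf (fun x => (hfρ x).trans (hM x)) hfi h1' k) hfi x)
      (conv_integrand (iterConv_measurable hρm k) (iterConv_nonneg hρ k)
      (iterConv_le hρm hρ hM hρi h1 k) hρi x)
      fun y => mul_le_mul (ih _) (hfρ _) (hf _) (iterConv_nonneg hρ k _)

lemma lap_conv {f g : ℝ → ℝ} {z : ℂ} (hf : Integrable fun x => (f x : ℂ) * Complex.exp (z * x))
    (hg : Integrable fun x => (g x : ℂ) * Complex.exp (z * x)) :
    Integrable (fun x => (convDens f g x : ℂ) * Complex.exp (z * x)) ∧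
    lap (convDens f g) z = lap f z * lap g z := by
  have H := hf.mul_prod hg
  have e : (fun p : ℝ × ℝ => (f p.1 : ℂ) * Complex.exp (z * p.1) * ((g p.2 : ℂ) *
      Complex.exp (z * p.2))) =
      fun p : ℝ × ℝ => (f p.1 * g p.2) • (fun x : ℝ => Complex.exp (z * x)) (p.1 + p.2) := by
    ext p
    simp only [Complex.real_smul]
    push_cast
    rw [mul_add, Complex.exp_add]; ring
  rw [e] at H
  have := conv_key (h := fun x : ℝ => Complex.exp (z * x)) H
  simp only [Complex.real_smul] at this
  refine ⟨this.1, ?_⟩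
  unfold lap
  rw [this.2, ← integral_prod_mul]
  congr 1
  ext p
  push_cast
  rw [mul_add, Complex.exp_add]; ring

lemma lap_iter {f : ℝ → ℝ} {z : ℂ} (hf : Integrable fun x => (f x : ℂ) * Complex.exp (z * x))
    (k : ℕ) :
    Integrable (fun x => (iterConv f k x : ℂ) * Complex.exp (z * x)) ∧
    lap (iterConv f k) z = lap f z ^ (k + 1) := by
  induction k with
  | zero => simpa [iterConv] using hf
  | succ k ih =>
    have := lap_conv ih.1 hf
    refine ⟨this.1, ?_⟩
    rw [pow_succ, ← ih.2, ← this.2]; rfl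

/-- Moments of convolutions. -/
lemma conv_moments {f g : ℝ → ℝ} (f0 : Integrable f) (f1 : Integrable fun x => x * f x)
    (f2 : Integrable fun x => x ^ 2 * f x)
    (g0 : Integrable g) (g1 : Integrable fun x => x * g x)
    (g2 : Integrable fun x => x ^ 2 * g x) :
    (Integrable (convDens f g) ∧ Integrable (fun x => x * convDens f g x) ∧
      Integrable fun x => x ^ 2 * convDens f g x) ∧
    ∫ x, convDens f g x = (∫ x, f x) * ∫ x, g x ∧
    ∫ x, x * convDens f g x = (∫ x, x * f x) * (∫ x, g x) + (∫ x, f x) * ∫ x, x * g x ∧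
    ∫ x, x ^ 2 * convDens f g x = (∫ x, x ^ 2 * f x) * (∫ x, g x)
      + 2 * ((∫ x, x * f x) * ∫ x, x * g x) + (∫ x, f x) * ∫ x, x ^ 2 * g x := by
  have K0 := conv_key (f := f) (g := g) (h := fun _ => (1 : ℝ)) (by
    simpa using f0.mul_prod g0)
  have a1 := (f1.mul_prod g0)
  have a2 := (f0.mul_prod g1)
  have b1 := (f2.mul_prod g0)
  have b2 := (f1.mul_prod g1).const_mul 2
  have b3 := (f0.mul_prod g2)
  have b12 : Integrable (fun p : ℝ × ℝ => p.1 ^ 2 * f p.1 * g p.2 +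
    2 * (p.1 * f p.1 * (p.2 * g p.2))) (volume.prod volume) := b1.add b2
  have e1 : (fun p : ℝ × ℝ => (f p.1 * g p.2) • (fun x => x) (p.1 + p.2)) =
    fun p : ℝ × ℝ => p.1 * f p.1 * g p.2 + f p.1 * (p.2 * g p.2) := by
    ext p; simp only [smul_eq_mul]; ring
  have e2 : (fun p : ℝ × ℝ => (f p.1 * g p.2) • (fun x => x ^ 2) (p.1 + p.2)) =
    fun p : ℝ × ℝ => p.1 ^ 2 * f p.1 * g p.2 + 2 * (p.1 * f p.1 * (p.2 * g p.2))
      + f p.1 * (p.2 ^ 2 * g p.2) := by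
    ext p; simp only [smul_eq_mul]; ring
  have K1 := conv_key (f := f) (g := g) (h := fun x => x) (by rw [e1]; exact a1.add a2)
  have K2 := conv_key (f := f) (g := g) (h := fun x => x ^ 2)
    (by rw [e2]; exact b12.add b3)
  rw [e1] at K1
  rw [e2] at K2
  simp only [smul_eq_mul, mul_one] at K0 K1 K2
  refine ⟨⟨K0.1, by simpa only [mul_comm] using K1.1, by simpa only [mul_comm] using K2.1⟩,
    ?_, ?_, ?_⟩
  · rw [K0.2, integral_prod_mul]
  · simp only [mul_comm _ (convDens f g _)]
    rw [K1.2, integral_add a1 a2, integral_prod_mul (fun x => x * f x) g,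
      integral_prod_mul f (fun x => x * g x)]
  · simp only [mul_comm _ (convDens f g _)]
    rw [K2.2, integral_add b12 b3, integral_add b1 b2, integral_const_mul,
      integral_prod_mul (fun x => x ^ 2 * f x) g,
      integral_prod_mul (fun x => x * f x) (fun x => x * g x),
      integral_prod_mul f (fun x => x ^ 2 * g x)]

lemma iter_moments {f : ℝ → ℝ} (f0 : Integrable f) (f1 : Integrable fun x => x * f x)
    (f2 : Integrable fun x => x ^ 2 * f x) (k : ℕ) :
    (Integrable (iterConv f k) ∧ Integrable (fun x => x * iterConv f k x) ∧
      Integrable fun x => x ^ 2 * iterConv f k x) ∧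
    ∫ x, iterConv f k x = (∫ x, f x) ^ (k + 1) ∧
    ∫ x, x * iterConv f k x = (k + 1) * (∫ x, f x) ^ k * (∫ x, x * f x) ∧
    ∫ x, x ^ 2 * iterConv f k x = (k + 1) * (∫ x, f x) ^ k * (∫ x, x ^ 2 * f x)
      + (k + 1) * k * (∫ x, f x) ^ (k - 1) * (∫ x, x * f x) ^ 2 := by
  induction k with
  | zero => simp [iterConv, f0, f1, f2]
  | succ k ih =>
    obtain ⟨⟨i0, i1, i2⟩, j0, j1, j2⟩ := ih
    obtain ⟨h, h0, h1, h2⟩ := conv_moments i0 i1 i2 f0 f1 f2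
    refine ⟨h, ?_, ?_, ?_⟩
    · change ∫ x, convDens (iterConv f k) f x = _
      rw [h0, j0]; ring
    · change ∫ x, x * convDens (iterConv f k) f x = _
      rw [h1, j0, j1]; push_cast; ring
    · change ∫ x, x ^ 2 * convDens (iterConv f k) f x = _
      rw [h2, j0, j1, j2]
      rcases k with _ | k
      · simp; ring
      · rw [Nat.add_sub_cancel, Nat.add_sub_cancel]; push_cast; ring

/-- Continuity off a countable set. -/
lemma iterConv_cont {f : ℝ → ℝ} {M : ℝ} (hfm : Measurable f) (hf : ∀ x, 0 ≤ f x)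
    (hM : ∀ x, f x ≤ M)
    (hfi : Integrable f) (h1 : ∫ x, f x ≤ 1) {S : Set ℝ} (hS : S.Countable)
    (hc : ∀ x, x ∉ S → ContinuousAt f x) (k : ℕ) : Continuous (iterConv f (k + 1)) := by
  have key : ∀ n, (∃ S : Set ℝ, S.Countable ∧ ∀ x, x ∉ S → ContinuousAt (iterConv f n) x) →
      Continuous (iterConv f (n + 1)) := by
    rintro n ⟨S, hS, hc⟩
    refine continuous_iff_continuousAt.2 fun x₀ => ?_
    have : ContinuousAt (fun x => ∫ y, iterConv f n (x - y) * f y) x₀ := by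
      refine continuousAt_of_dominated (bound := fun y => M * f y)
        (Filter.Eventually.of_forall fun x => ?_)
        (Filter.Eventually.of_forall fun x => Filter.Eventually.of_forall fun y => ?_)
        (hfi.const_mul M) ?_
      · exact (conv_integrand (iterConv_measurable hfm n) (iterConv_nonneg hf n)
          (iterConv_le hfm hf hM hfi h1 n) hfi x).1
      · rw [Real.norm_of_nonneg (mul_nonneg (iterConv_nonneg hf n _) (hf _))]
        exact mul_le_mul_of_nonneg_right (iterConv_le hfm hf hM hfi h1 n _) (hf _)
      · have hz : (volume : Measure ℝ) ((fun y => x₀ - y) ⁻¹' S) = 0 := by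
          apply Set.Countable.measure_zero
          exact hS.preimage (sub_right_injective)
        filter_upwards [compl_mem_ae_iff.2 hz] with y hy
        have : ContinuousAt (iterConv f n) (x₀ - y) := hc _ hy
        exact (ContinuousAt.comp (f := fun x => x - y) this (by fun_prop)).mul continuousAt_const
    exact this
  induction k with
  | zero => exact key 0 ⟨S, hS, hc⟩
  | succ k ih => exact key (k + 1) ⟨∅, by simp, fun x _ => ih.continuousAt⟩


lemma dens_basic (ρ : ℝ → ℝ) (hpos : ∀ x, 0 ≤ ρ x) (hi : Integrable ρ)
    (hdiff : Differentiable ℝ fun x => Real.sqrt (ρ x))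
    (hFisher : Integrable fun x => (deriv (fun y => Real.sqrt (ρ y)) x) ^ 2) :
    Continuous ρ ∧ ∃ W : ℝ, 0 < W ∧ (∀ x, ρ x ≤ W) ∧
      ∀ B r t : ℝ, 0 ≤ B → t ≠ 0 →
        ‖∫ x in (-B)..B, (ρ x : ℂ) * Complex.exp ((r + t * Complex.I) * x)‖
          ≤ W * Real.exp (|r| * B) / |t| := by
  set s : ℝ → ℝ := fun x => Real.sqrt (ρ x) with hs
  have hρs : ∀ x, ρ x = s x ^ 2 := fun x => (Real.sq_sqrt (hpos x)).symm
  set d : ℝ → ℝ := fun x => 2 * s x * deriv s x with hd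
  have hder : ∀ x, HasDerivAt ρ (d x) x := by
    intro x
    have h1 := (hdiff x).hasDerivAt.pow 2
    have h2 : (fun x => s x ^ 2) = ρ := funext fun x => (hρs x).symm
    rw [← h2]
    convert! h1 using 1
    simp [hd]
  have hdm : Measurable d := (measurable_const.mul hdiff.continuous.measurable).mul
    (measurable_deriv s)
  have hdi : Integrable d := by
    refine (hi.add hFisher).mono' hdm.aestronglyMeasurable (Filter.Eventually.of_forall fun x => ?_)
    rw [Real.norm_eq_abs, abs_le]
    have := hρs x
    simp only [Pi.add_apply, hd]
    change -(ρ x + deriv s x ^ 2) ≤ _ ∧ _ ≤ ρ x + deriv s x ^ 2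
    rw [this]
    constructor <;> nlinarith [sq_nonneg (s x + deriv s x), sq_nonneg (s x - deriv s x)]
  have hcont : Continuous ρ := continuous_iff_continuousAt.2 fun x => (hder x).continuousAt
  set K := ∫ x, |d x| with hK
  have hK0 : 0 ≤ K := integral_nonneg fun x => abs_nonneg _
  have hKab : ∀ a b : ℝ, a ≤ b → ∫ x in a..b, |d x| ≤ K := by
    intro a b hab
    rw [intervalIntegral.integral_of_le hab]
    exact setIntegral_le_integral hdi.abs (Filter.Eventually.of_forall fun x => abs_nonneg _)
  have hM : ∀ x, ρ x ≤ ρ 0 + K := by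
    intro x
    have h := intervalIntegral.integral_eq_sub_of_hasDerivAt (a := 0) (b := x)
      (fun y _ => hder y) hdi.intervalIntegrable
    have h2 : |∫ y in (0:ℝ)..x, d y| ≤ K := by
      refine (intervalIntegral.norm_integral_le_integral_norm_uIoc (f := d) (μ := volume)).trans ?_
      exact setIntegral_le_integral hdi.abs (Filter.Eventually.of_forall fun x => abs_nonneg _)
    have := le_abs_self (∫ y in (0:ℝ)..x, d y)
    linarith
  set M := ρ 0 + K with hMd
  have hM0 : 0 ≤ M := by have := hpos 0; positivity
  refine ⟨hcont, 2 * M + K + 1, by positivity, fun x => (hM x).trans (by linarith), ?_⟩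
  intro B r t hB ht
  set z : ℂ := r + t * Complex.I with hz
  have hzt : |t| ≤ ‖z‖ := by
    have := Complex.abs_im_le_norm z
    simpa [hz] using this
  have ht0 : 0 < |t| := abs_pos.2 ht
  have hz0 : z ≠ 0 := norm_pos_iff.1 (ht0.trans_le hzt)
  have hu : ∀ x ∈ uIcc (-B) B, HasDerivAt (fun x => (ρ x : ℂ)) (d x : ℂ) x :=
    fun x _ => (hder x).ofReal_comp
  have hv : ∀ x ∈ uIcc (-B) B, HasDerivAt (fun x : ℝ => Complex.exp (z * x) / z)
      (Complex.exp (z * x)) x := by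
    intro x _
    have h1 : HasDerivAt (fun x : ℝ => z * (x : ℂ)) z x := by
      simpa using (Complex.ofRealCLM.hasDerivAt (x := x)).const_mul z
    have := (h1.cexp).div_const z
    simpa [hz0] using this
  have ibp := intervalIntegral.integral_mul_deriv_eq_deriv_mul hu hv
    (hdi.ofReal.intervalIntegrable) (Continuous.intervalIntegrable (by fun_prop) _ _)
  have hexp : ∀ x : ℝ, |x| ≤ B → ‖Complex.exp (z * x)‖ ≤ Real.exp (|r| * B) := by
    intro x hx
    rw [Complex.norm_exp]
    apply Real.exp_le_exp.2
    have : (z * x).re = r * x := by simp [hz]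
    rw [this]
    calc r * x ≤ |r * x| := le_abs_self _
      _ = |r| * |x| := abs_mul _ _
      _ ≤ _ := by gcongr
  have hbd : ∀ x : ℝ, |x| ≤ B → ‖Complex.exp (z * x) / z‖ ≤ Real.exp (|r| * B) / |t| := by
    intro x hx
    rw [norm_div]
    gcongr
    exact hexp x hx
  set Q := Real.exp (|r| * B) / |t| with hQ
  have hQ0 : 0 ≤ Q := by positivity
  rw [ibp]
  have t1 : ‖(ρ B : ℂ) * (Complex.exp (z * (B : ℝ)) / z)‖ ≤ M * Q := by
    rw [norm_mul]
    have : ‖(ρ B : ℂ)‖ ≤ M := by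
      rw [Complex.norm_real, Real.norm_of_nonneg (hpos _)]; exact hM _
    gcongr
    exact hbd B (by rw [abs_of_nonneg hB])
  have t2 : ‖(ρ (-B) : ℂ) * (Complex.exp (z * ((-B : ℝ) : ℂ)) / z)‖ ≤ M * Q := by
    rw [norm_mul]
    have : ‖(ρ (-B) : ℂ)‖ ≤ M := by
      rw [Complex.norm_real, Real.norm_of_nonneg (hpos _)]; exact hM _
    gcongr
    exact hbd (-B) (by rw [abs_neg, abs_of_nonneg hB])
  have t3 : ‖∫ x in (-B)..B, (d x : ℂ) * (Complex.exp (z * x) / z)‖ ≤ K * Q := by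
    have hBB : -B ≤ B := by linarith
    have := intervalIntegral.norm_integral_le_of_norm_le (a := -B) (b := B) (μ := volume)
      (f := fun x : ℝ => (d x : ℂ) * (Complex.exp (z * x) / z)) (g := fun x => |d x| * Q) hBB
      (Filter.Eventually.of_forall fun x hx => by
        rw [norm_mul, Complex.norm_real, Real.norm_eq_abs]
        gcongr
        exact hbd x (abs_le.2 ⟨hx.1.le, hx.2⟩)) (hdi.abs.mul_const Q).intervalIntegrable
    refine this.trans ?_
    rw [intervalIntegral.integral_mul_const]
    exact mul_le_mul_of_nonneg_right (hKab _ _ hBB) hQ0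
  calc _ ≤ M * Q + M * Q + K * Q := by
        refine (norm_sub_le _ _).trans (add_le_add ((norm_sub_le _ _).trans (add_le_add t1 t2)) t3)
    _ ≤ (2 * M + K + 1) * Q := by nlinarith
    _ = _ := by rw [hQ]; ring

lemma lap_trunc (ρ : ℝ → ℝ) (B : ℝ) (hB : 0 ≤ B) (z : ℂ) :
    lap ((Icc (-B) B).indicator ρ) z = ∫ x in (-B)..B, (ρ x : ℂ) * Complex.exp (z * x) := by
  unfold lap
  rw [intervalIntegral.integral_of_le (by linarith), ← integral_Icc_eq_integral_Ioc,
    ← integral_indicator measurableSet_Icc]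
  congr 1
  ext x
  by_cases hx : x ∈ Icc (-B) B <;> simp [hx]

lemma lap_integrable_im (ρ : ℝ → ℝ) (hi : Integrable ρ) (t : ℝ) :
    Integrable fun x => (ρ x : ℂ) * Complex.exp ((t * Complex.I) * x) := by
  refine hi.ofReal.mul_bdd (c := 1) (by fun_prop) (Filter.Eventually.of_forall fun x => ?_)
  rw [show ((t : ℂ) * Complex.I) * x = ((t * x : ℝ) : ℂ) * Complex.I by push_cast; ring,
    Complex.norm_exp_ofReal_mul_I]

lemma lap_decay (ρ : ℝ → ℝ) (hi : Integrable ρ) (W : ℝ)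
    (hW : ∀ B r t : ℝ, 0 ≤ B → t ≠ 0 →
        ‖∫ x in (-B)..B, (ρ x : ℂ) * Complex.exp ((r + t * Complex.I) * x)‖
          ≤ W * Real.exp (|r| * B) / |t|) (t : ℝ) (ht : t ≠ 0) :
    ‖lap ρ (t * Complex.I)‖ ≤ W / |t| := by
  have h := intervalIntegral_tendsto_integral (lap_integrable_im ρ hi t)
    Filter.tendsto_neg_atTop_atBot Filter.tendsto_id
  refine le_of_tendsto h.norm ?_
  filter_upwards [Filter.eventually_ge_atTop 0] with B hB
  simpa using hW B 0 t hB ht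

lemma lap_cont (ρ : ℝ → ℝ) (hi : Integrable ρ) : Continuous fun t : ℝ => lap ρ (t * Complex.I) := by
  unfold lap
  refine continuous_of_dominated (bound := fun x => ‖ρ x‖)
    (fun t => (lap_integrable_im ρ hi t).1) (fun t => Filter.Eventually.of_forall fun x => ?_)
    hi.norm (Filter.Eventually.of_forall fun x => by fun_prop)
  rw [norm_mul, Complex.norm_real,
    show ((t : ℂ) * Complex.I) * x = ((t * x : ℝ) : ℂ) * Complex.I by push_cast; ring,
    Complex.norm_exp_ofReal_mul_I, mul_one]

lemma lap_lt_one (ρ : ℝ → ℝ) (hpos : ∀ x, 0 ≤ ρ x) (hi : Integrable ρ) (h1 : ∫ x, ρ x = 1)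
    (t : ℝ) (ht : t ≠ 0) : ‖lap ρ (t * Complex.I)‖ < 1 := by
  by_contra hcon
  push Not at hcon
  set L := lap ρ (t * Complex.I) with hL
  -- rotate
  set θ := Complex.arg L with hθ
  have hrot : L * Complex.exp (-(θ * Complex.I)) = ‖L‖ := by
    conv_lhs => rw [← Complex.norm_mul_exp_arg_mul_I L]
    rw [mul_assoc, ← Complex.exp_add]; simp [hθ]
  have hIntg : Integrable fun x => ρ x * Real.cos (t * x - θ) := by
    refine hi.mul_bdd (c := 1) (by fun_prop) (Filter.Eventually.of_forall fun x => ?_)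
    exact Real.abs_cos_le_one _
  have e1 : ∫ x, ρ x * Real.cos (t * x - θ) = ‖L‖ := by
    have h2 : ∫ x, ((ρ x : ℂ) * Complex.exp ((t * Complex.I) * x)) * Complex.exp (-(θ * Complex.I))
        = ‖L‖ := by
      rw [integral_mul_const]; exact hrot
    have h3 := congrArg Complex.re h2
    rw [Complex.ofReal_re] at h3
    rw [← h3]
    have h4 := integral_re (((lap_integrable_im ρ hi t).mul_const (Complex.exp (-(θ * Complex.I)))))
    simp only [RCLike.re_to_complex] at h4
    rw [← h4]
    congr 1
    ext x
    rw [mul_assoc, ← Complex.exp_add, show ((t : ℂ) * Complex.I) * x + -(θ * Complex.I) =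
      ((t * x - θ : ℝ) : ℂ) * Complex.I by push_cast; ring, Complex.re_ofReal_mul,
      Complex.exp_ofReal_mul_I_re]
  have e2 : ∫ x, ρ x * (1 - Real.cos (t * x - θ)) = 0 := by
    have hnn : 0 ≤ ∫ x, ρ x * (1 - Real.cos (t * x - θ)) :=
      integral_nonneg fun x => mul_nonneg (hpos x) (by linarith [Real.cos_le_one (t * x - θ)])
    have : ∫ x, ρ x * (1 - Real.cos (t * x - θ)) = 1 - ‖L‖ := by
      rw [← e1]
      nth_rewrite 2 [← h1]
      rw [← integral_sub hi hIntg]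
      refine integral_congr_ae (Filter.Eventually.of_forall fun x => ?_)
      simp only; ring
    linarith
  have hIntg2 : Integrable fun x => ρ x * (1 - Real.cos (t * x - θ)) := by
    have := hi.sub hIntg
    refine this.congr (Filter.Eventually.of_forall fun x => ?_)
    simp only [Pi.sub_apply]; ring
  have e3 := (integral_eq_zero_iff_of_nonneg (fun x => mul_nonneg (hpos x)
    (by linarith [Real.cos_le_one (t * x - θ)])) hIntg2).1 e2
  have hcount : {x : ℝ | Real.cos (t * x - θ) = 1}.Countable := by
    have : {x : ℝ | Real.cos (t * x - θ) = 1} ⊆ Set.range fun n : ℤ => (n * (2 * π) + θ) / t := by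
      intro x hx
      obtain ⟨n, hn⟩ := (Real.cos_eq_one_iff _).1 hx
      refine ⟨n, ?_⟩
      simp only
      rw [hn]; field_simp; ring
    exact (Set.countable_range _).mono this
  have e4 : ρ =ᵐ[volume] 0 := by
    filter_upwards [e3, compl_mem_ae_iff.2 (hcount.measure_zero volume)] with x hx hx2
    simp only [Pi.zero_apply, mul_eq_zero] at hx ⊢
    rcases hx with hx | hx
    · exact hx
    · exact absurd (show Real.cos (t * x - θ) = 1 by linarith) hx2
  rw [integral_congr_ae e4] at h1
  simp at h1

lemma lap_q (ρ : ℝ → ℝ) (hpos : ∀ x, 0 ≤ ρ x) (hi : Integrable ρ) (h1 : ∫ x, ρ x = 1) (W : ℝ)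
    (hW0 : 0 < W) (hd : ∀ t : ℝ, t ≠ 0 → ‖lap ρ (t * Complex.I)‖ ≤ W / |t|) (ε : ℝ) (hε : 0 < ε) :
    ∃ q < 1, 0 ≤ q ∧ ∀ t : ℝ, ε ≤ |t| → ‖lap ρ (t * Complex.I)‖ ≤ q := by
  set K : Set ℝ := Icc (-(2 * W)) (2 * W) ∩ {t | ε ≤ |t|} with hK
  have hKc : IsCompact K := isCompact_Icc.inter_right (isClosed_le continuous_const continuous_abs)
  have hbig : ∀ t : ℝ, ε ≤ |t| → t ∉ K → ‖lap ρ (t * Complex.I)‖ ≤ 1 / 2 := by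
    intro t ht htK
    have : 2 * W < |t| := by
      by_contra hc
      push Not at hc
      exact htK ⟨abs_le.1 hc, ht⟩
    refine (hd t (abs_pos.1 (hε.trans_le ht))).trans ?_
    rw [div_le_iff₀ (by linarith)]; linarith
  rcases K.eq_empty_or_nonempty with h | h
  · refine ⟨1 / 2, by norm_num, by norm_num, fun t ht => hbig t ht (by simp [h])⟩
  · obtain ⟨t0, ht0, hmax⟩ := hKc.exists_isMaxOn h (lap_cont ρ hi).norm.continuousOn
    refine ⟨max (1 / 2) ‖lap ρ (t0 * Complex.I)‖, max_lt (by norm_num)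
      (lap_lt_one ρ hpos hi h1 t0 (abs_pos.1 (hε.trans_le ht0.2))), by positivity, fun t ht => ?_⟩
    by_cases htK : t ∈ K
    · exact (hmax htK).trans (le_max_right _ _)
    · exact (hbig t ht htK).trans (le_max_left _ _)


lemma exp_step (h h' : ℝ → ℂ) (C : ℝ) (hd : ∀ s, HasDerivAt h (h' s) s)
    (hb : ∀ s ∈ Icc (0:ℝ) 1, ‖h' s‖ ≤ C) (h0 : h 0 = 0) : ∀ s ∈ Icc (0:ℝ) 1, ‖h s‖ ≤ C := by
  intro s hs
  have := norm_image_sub_le_of_norm_deriv_le_segment' (f := h) (f' := h') (a := 0) (b := 1) (C := C)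
    (fun x _ => (hd x).hasDerivWithinAt) (fun x hx => hb x ⟨hx.1, hx.2.le⟩) s hs
  rw [h0, sub_zero, sub_zero] at this
  have hC : 0 ≤ C := (norm_nonneg _).trans (hb 0 (by simp))
  nlinarith [hs.2]

lemma exp_taylor (u : ℂ) :
    ‖Complex.exp u - 1‖ ≤ ‖u‖ * Real.exp |u.re| ∧
    ‖Complex.exp u - 1 - u - u ^ 2 / 2‖ ≤ ‖u‖ ^ 3 * Real.exp |u.re| := by
  have hE : ∀ s ∈ Icc (0:ℝ) 1, ‖Complex.exp (s * u)‖ ≤ Real.exp |u.re| := by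
    intro s hs
    rw [Complex.norm_exp]
    apply Real.exp_le_exp.2
    simp only [Complex.mul_re, Complex.ofReal_re, Complex.ofReal_im, zero_mul, sub_zero]
    calc s * u.re ≤ |s * u.re| := le_abs_self _
      _ = s * |u.re| := by rw [abs_mul, abs_of_nonneg hs.1]
      _ ≤ 1 * |u.re| := by gcongr; exact hs.2
      _ = _ := one_mul _
  have hid : ∀ s : ℝ, HasDerivAt (fun s : ℝ => (s : ℂ) * u) u s := by
    intro s
    simpa using (Complex.ofRealCLM.hasDerivAt (x := s)).mul_const u
  have hid2 : ∀ s : ℝ, HasDerivAt (fun s : ℝ => ((s : ℂ) * u) ^ 2 / 2) (((s : ℂ) * u) * u) s := by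
    intro s
    have := ((hid s).pow 2).div_const 2
    convert! this using 1
    push_cast; ring
  have h1 := exp_step (fun s => Complex.exp (s * u) - 1) (fun s => Complex.exp (s * u) * u)
    (‖u‖ * Real.exp |u.re|) (fun s => ((hid s).cexp).sub_const 1) (fun s hs => by
      rw [norm_mul, mul_comm]; gcongr; exact hE s hs) (by simp)
  have h2 := exp_step (fun s => Complex.exp (s * u) - 1 - s * u)
    (fun s => (Complex.exp (s * u) - 1) * u)
    (‖u‖ ^ 2 * Real.exp |u.re|) (fun s => by
      have := (((hid s).cexp).sub_const 1).sub (hid s)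
      convert! this using 1; ring) (fun s hs => by
      rw [norm_mul]
      have := h1 s hs
      calc _ ≤ (‖u‖ * Real.exp |u.re|) * ‖u‖ := by gcongr
        _ = _ := by ring) (by simp)
  have h3 := exp_step (fun s => Complex.exp (s * u) - 1 - s * u - ((s : ℂ) * u) ^ 2 / 2)
    (fun s => (Complex.exp (s * u) - 1 - s * u) * u)
    (‖u‖ ^ 3 * Real.exp |u.re|) (fun s => by
      have := ((((hid s).cexp).sub_const 1).sub (hid s)).sub (hid2 s)
      convert! this using 1; ring) (fun s hs => by
      rw [norm_mul]
      have := h2 s hs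
      calc _ ≤ (‖u‖ ^ 2 * Real.exp |u.re|) * ‖u‖ := by gcongr
        _ = _ := by ring) (by simp)
  have a := h1 1 (by simp)
  have b := h3 1 (by simp)
  simp only [Complex.ofReal_one, one_mul] at a b
  exact ⟨a, b⟩

lemma pow_diff (a b : ℂ) (E : ℝ) (ha : ‖a‖ ≤ E) (hb : ‖b‖ ≤ E) (n : ℕ) :
    ‖a ^ (n + 1) - b ^ (n + 1)‖ ≤ (n + 1) * ‖a - b‖ * E ^ n := by
  have hE : 0 ≤ E := (norm_nonneg _).trans ha
  induction n with
  | zero => simp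
  | succ n ih =>
    have e : a ^ (n + 1 + 1) - b ^ (n + 1 + 1)
        = a * (a ^ (n + 1) - b ^ (n + 1)) + (a - b) * b ^ (n + 1) := by ring
    rw [e]
    refine (norm_add_le _ _).trans ?_
    rw [norm_mul, norm_mul, norm_pow]
    have h1 : ‖b‖ ^ (n + 1) ≤ E ^ (n + 1) := by gcongr
    calc _ ≤ E * ((n + 1) * ‖a - b‖ * E ^ n) + ‖a - b‖ * E ^ (n + 1) := by gcongr
      _ = _ := by push_cast; ring

/-- weight integrability -/
lemma lapB_point (ρx fx x r t σ : ℝ) (hσ : 1 ≤ σ) (h0 : 0 ≤ fx) (h1 : fx ≤ ρx)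
    (heq : |x| ≤ σ → fx = ρx) (hs : fx ≠ 0 → Real.exp (|r| * |x| / σ) ≤ 3 + |x|)
    (ζ : ℂ) (hζ : ζ = r + t * Complex.I) :
    ‖(fx : ℂ) * Complex.exp (ζ / σ * x)‖ ≤ ρx * (3 + |x|) ∧
    ‖(fx : ℂ) * Complex.exp (ζ / σ * x) - ρx * (1 + ζ / σ * x + (ζ / σ * x) ^ 2 / 2)‖
      ≤ ρx * (|x| ^ 3 * (3 + |x|)) * (4 * (1 + ‖ζ‖ ^ 3) / σ ^ 3) ∧
    ‖(fx : ℂ) * Complex.exp (ζ / σ * x) - ρx * Complex.exp (((t / σ : ℝ) : ℂ) * Complex.I * x)‖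
      ≤ ρx * (|x| * (3 + |x|)) * ((1 + |r|) / σ) := by
  have hσ0 : 0 < σ := by linarith
  have hρ : 0 ≤ ρx := h0.trans h1
  set u : ℂ := ζ / σ * x with hu
  have hure : u.re = r * x / σ := by
    have : u = ((r * x / σ : ℝ) : ℂ) + ((t * x / σ : ℝ) : ℂ) * Complex.I := by
      rw [hu, hζ]; push_cast; ring
    rw [this]; simp only [Complex.add_re, Complex.re_ofReal_mul, Complex.ofReal_re, Complex.I_re,
      mul_zero, add_zero]
  have hureabs : |u.re| = |r| * |x| / σ := by
    rw [hure, abs_div, abs_mul, abs_of_pos hσ0]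
  have hun : ‖u‖ = ‖ζ‖ * (|x| / σ) := by
    rw [hu, norm_mul, norm_div, Complex.norm_real, Complex.norm_real, Real.norm_of_nonneg hσ0.le,
      Real.norm_eq_abs]; ring
  have hE : fx * Real.exp |u.re| ≤ fx * (3 + |x|) := by
    rcases eq_or_ne fx 0 with h | h
    · simp [h]
    · rw [hureabs]; gcongr; exact hs h
  have hE' : fx * Real.exp |u.re| ≤ ρx * (3 + |x|) :=
    hE.trans (by gcongr)
  have hx0 := abs_nonneg x
  set y := |x| / σ with hy
  have hy0 : 0 ≤ y := by positivity
  have hxy : |x| = y * σ := by rw [hy]; field_simp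
  have htail : ρx - fx ≠ 0 → 1 ≤ y := by
    intro hne
    by_contra hc
    push Not at hc
    apply hne
    rw [heq, sub_self]
    rw [hxy]; nlinarith
  refine ⟨?_, ?_, ?_⟩
  · rw [norm_mul, Complex.norm_real, Real.norm_of_nonneg h0, Complex.norm_exp]
    refine le_trans ?_ hE'
    gcongr
    exact le_abs_self _
  · have e : (fx : ℂ) * Complex.exp u - ρx * (1 + u + u ^ 2 / 2)
        = fx * (Complex.exp u - 1 - u - u ^ 2 / 2)
          - ((ρx - fx : ℝ) : ℂ) * (1 + u + u ^ 2 / 2) := by push_cast; ring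
    rw [e]
    refine (norm_sub_le _ _).trans ?_
    rw [norm_mul, norm_mul, Complex.norm_real, Complex.norm_real, Real.norm_of_nonneg h0,
      Real.norm_of_nonneg (sub_nonneg.2 h1)]
    set Z := ‖ζ‖ with hZ
    have hZ0 : 0 ≤ Z := norm_nonneg _
    have b1 : fx * ‖Complex.exp u - 1 - u - u ^ 2 / 2‖ ≤ ρx * (3 + |x|) * (Z ^ 3 * y ^ 3) := by
      calc _ ≤ fx * (‖u‖ ^ 3 * Real.exp |u.re|) := by gcongr; exact (exp_taylor u).2
        _ = (fx * Real.exp |u.re|) * (Z ^ 3 * y ^ 3) := by rw [hun]; ring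
        _ ≤ _ := by gcongr
    have n1 : ‖1 + u + u ^ 2 / 2‖ ≤ 1 + Z * y + Z ^ 2 * y ^ 2 := by
      refine (norm_add_le _ _).trans ?_
      refine add_le_add ((norm_add_le _ _).trans ?_) ?_
      · rw [hun]; simp
      · rw [norm_div, norm_pow, hun]
        simp only [Complex.norm_ofNat]
        rw [div_le_iff₀ (by norm_num)]
        nlinarith [mul_nonneg (sq_nonneg Z) (sq_nonneg y)]
    have b2 : (ρx - fx) * ‖1 + u + u ^ 2 / 2‖ ≤ ρx * (3 + |x|) * ((1 + Z + Z ^ 2) * y ^ 3) := by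
      rcases eq_or_ne (ρx - fx) 0 with h | h
      · rw [h, zero_mul]; positivity
      · have hy1 := htail h
        have y2 : y ≤ y ^ 2 := by nlinarith
        have y3 : y ^ 2 ≤ y ^ 3 := by nlinarith [sq_nonneg y]
        have : 1 + Z * y + Z ^ 2 * y ^ 2 ≤ (1 + Z + Z ^ 2) * y ^ 3 := by
          have : Z * y ≤ Z * y ^ 3 := by gcongr; linarith
          have : Z ^ 2 * y ^ 2 ≤ Z ^ 2 * y ^ 3 := by gcongr
          nlinarith
        calc _ ≤ ρx * (1 + Z * y + Z ^ 2 * y ^ 2) := by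
              gcongr; linarith
          _ ≤ (ρx * (3 + |x|)) * ((1 + Z + Z ^ 2) * y ^ 3) := by
              gcongr
              nlinarith
    have hZZ : 1 + Z + Z ^ 2 + Z ^ 3 ≤ 4 * (1 + Z ^ 3) := by
      nlinarith [mul_nonneg hZ0 (sq_nonneg (Z - 1)), sq_nonneg (Z - 1), sq_nonneg (Z + 1)]
    have e2 : ρx * (|x| ^ 3 * (3 + |x|)) * (4 * (1 + Z ^ 3) / σ ^ 3)
        = ρx * (3 + |x|) * (4 * (1 + Z ^ 3) * y ^ 3) := by
      rw [hy]; field_simp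
    rw [e2]
    calc _ ≤ ρx * (3 + |x|) * (Z ^ 3 * y ^ 3) + ρx * (3 + |x|) * ((1 + Z + Z ^ 2) * y ^ 3) :=
          add_le_add b1 b2
      _ = ρx * (3 + |x|) * ((1 + Z + Z ^ 2 + Z ^ 3) * y ^ 3) := by ring
      _ ≤ _ := by gcongr
  · have hsplit : Complex.exp u = Complex.exp ((r * x / σ : ℝ) : ℂ) *
        Complex.exp (((t / σ : ℝ) : ℂ) * Complex.I * x) := by
      rw [← Complex.exp_add, hu, hζ]; congr 1; push_cast; ring
    set w : ℂ := Complex.exp (((t / σ : ℝ) : ℂ) * Complex.I * x) with hw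
    have hwn : ‖w‖ = 1 := by
      rw [hw, show ((t / σ : ℝ) : ℂ) * Complex.I * x = ((t / σ * x : ℝ) : ℂ) * Complex.I by
        push_cast; ring, Complex.norm_exp_ofReal_mul_I]
    have e : (fx : ℂ) * Complex.exp u - ρx * w = (fx * (Complex.exp ((r * x / σ : ℝ) : ℂ) - 1)
      - ((ρx - fx : ℝ) : ℂ)) * w := by rw [hsplit]; push_cast; ring
    rw [e, norm_mul, hwn, mul_one]
    refine (norm_sub_le _ _).trans ?_
    rw [norm_mul, Complex.norm_real, Complex.norm_real, Real.norm_of_nonneg h0,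
      Real.norm_of_nonneg (sub_nonneg.2 h1)]
    have b1 : fx * ‖Complex.exp ((r * x / σ : ℝ) : ℂ) - 1‖ ≤ ρx * (3 + |x|) * (|r| * y) := by
      have h := (exp_taylor ((r * x / σ : ℝ) : ℂ)).1
      rw [Complex.ofReal_re, Complex.norm_real, Real.norm_eq_abs] at h
      have h2 : |r * x / σ| = |r| * y := by rw [abs_div, abs_mul, abs_of_pos hσ0, hy]; ring
      rw [hure] at hE'
      calc _ ≤ fx * (|r * x / σ| * Real.exp |r * x / σ|) := by gcongr
        _ = fx * Real.exp |r * x / σ| * (|r| * y) := by rw [← h2]; ring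
        _ ≤ _ := by gcongr
    have b2 : ρx - fx ≤ ρx * (3 + |x|) * y := by
      rcases eq_or_ne (ρx - fx) 0 with h | h
      · rw [h]; positivity
      · have hy1 := htail h
        have : 1 ≤ (3 + |x|) * y := by nlinarith
        nlinarith
    have e2 : ρx * (|x| * (3 + |x|)) * ((1 + |r|) / σ) = ρx * (3 + |x|) * (|r| * y)
      + ρx * (3 + |x|) * y := by rw [hy]; ring
    rw [e2]
    exact add_le_add b1 b2


/-- The facts about the density that are used below. -/
structure GoodDens (ρ : ℝ → ℝ) (W : ℝ) : Prop where
  meas : Measurable ρ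
  pos : ∀ x, 0 ≤ ρ x
  int : Integrable ρ
  mass : ∫ x, ρ x = 1
  mean : ∫ x, x * ρ x = 0
  var : ∫ x, x ^ 2 * ρ x = 1
  i1 : Integrable fun x => x * ρ x
  i2 : Integrable fun x => x ^ 2 * ρ x
  i4 : Integrable fun x => x ^ 4 * ρ x
  W0 : 0 < W
  cont : Continuous ρ
  bdd : ∀ x, ρ x ≤ W
  decay : ∀ B r t : ℝ, 0 ≤ B → t ≠ 0 →
        ‖∫ x in (-B)..B, (ρ x : ℂ) * Complex.exp ((r + t * Complex.I) * x)‖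
          ≤ W * Real.exp (|r| * B) / |t|

lemma GoodDens.integrable_poly {ρ : ℝ → ℝ} {W : ℝ} (h : GoodDens ρ W) (p : ℝ → ℝ)
    (hp : Continuous p) (C : ℝ) (hC : ∀ x, |p x| ≤ C * (1 + x ^ 4)) :
    Integrable fun x => ρ x * p x := by
  have := (h.int.add h.i4).const_mul C
  refine this.mono' ((h.meas.mul hp.measurable).aestronglyMeasurable)
    (Filter.Eventually.of_forall fun x => ?_)
  rw [norm_mul, Real.norm_of_nonneg (h.pos x), Real.norm_eq_abs]
  calc ρ x * |p x| ≤ ρ x * (C * (1 + x ^ 4)) := mul_le_mul_of_nonneg_left (hC x) (h.pos x)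
    _ = _ := by simp only [Pi.add_apply]; ring

/-- Admissible truncations of `ρ`. -/
structure Adm (ρ f : ℝ → ℝ) (r σ : ℝ) : Prop where
  meas : Measurable f
  pos : ∀ x, 0 ≤ f x
  le : ∀ x, f x ≤ ρ x
  eq : ∀ x, |x| ≤ σ → f x = ρ x
  supp : ∀ x, f x ≠ 0 → Real.exp (|r| * |x| / σ) ≤ 3 + |x|

lemma lapB_int {ρ : ℝ → ℝ} {W : ℝ} (h : GoodDens ρ W) :
    ∃ C0 > 0, ∀ (f : ℝ → ℝ) (r σ : ℝ), 1 ≤ σ → Adm ρ f r σ → ∀ (t : ℝ) (ζ : ℂ),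
      ζ = r + t * Complex.I →
      Integrable (fun x : ℝ => (f x : ℂ) * Complex.exp (ζ / σ * x)) ∧
      ‖lap f (ζ / σ) - 1 - ζ ^ 2 / (2 * σ ^ 2)‖ ≤ C0 * (1 + ‖ζ‖ ^ 3) / σ ^ 3 ∧
      ‖lap f (ζ / σ)‖ ≤ ‖lap ρ (((t / σ : ℝ) : ℂ) * Complex.I)‖ + C0 * ((1 + |r|) / σ) := by
  have iA := h.integrable_poly (fun x => 3 + |x|) (by fun_prop) 4 (fun x => by
    rw [abs_of_nonneg (by positivity)]
    have : x ^ 4 = |x| ^ 4 := by rw [Even.pow_abs (by decide)]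
    rw [this]
    nlinarith [sq_nonneg (|x| ^ 2 - 1), sq_nonneg (|x| - 1), sq_nonneg (|x| ^ 2)])
  have iB := h.integrable_poly (fun x => |x| ^ 3 * (3 + |x|)) (by fun_prop) 4 (fun x => by
    rw [abs_of_nonneg (by positivity)]
    have : x ^ 4 = |x| ^ 4 := by rw [Even.pow_abs (by decide)]
    rw [this]
    nlinarith [mul_nonneg (sq_nonneg (|x|)) (sq_nonneg (|x| - 1)), sq_nonneg (|x|^2 - 1),
      sq_nonneg (|x| ^ 2)])
  have iC := h.integrable_poly (fun x => |x| * (3 + |x|)) (by fun_prop) 4 (fun x => by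
    rw [abs_of_nonneg (by positivity)]
    have : x ^ 4 = |x| ^ 4 := by rw [Even.pow_abs (by decide)]
    rw [this]
    nlinarith [sq_nonneg (|x| ^ 2 - 1), sq_nonneg (|x| - 1), sq_nonneg (|x| ^ 2)])
  set KB := ∫ x, ρ x * (|x| ^ 3 * (3 + |x|)) with hKB
  set KC := ∫ x, ρ x * (|x| * (3 + |x|)) with hKC
  have hKB0 : 0 ≤ KB := integral_nonneg fun x => mul_nonneg (h.pos x) (by positivity)
  have hKC0 : 0 ≤ KC := integral_nonneg fun x => mul_nonneg (h.pos x) (by positivity)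
  refine ⟨4 * KB + KC + 1, by positivity, ?_⟩
  intro f r σ hσ hf t ζ hζ
  have hσ0 : 0 < σ := by linarith
  have P := fun x => lapB_point (ρ x) (f x) x r t σ hσ (hf.pos x) (hf.le x) (hf.eq x) (hf.supp x) ζ hζ
  have hIntg : Integrable (fun x : ℝ => (f x : ℂ) * Complex.exp (ζ / σ * x)) := by
    refine iA.mono' ?_ (Filter.Eventually.of_forall fun x => (P x).1)
    exact (hf.meas.complex_ofReal.mul (by fun_prop)).aestronglyMeasurable
  have c1 : Integrable (fun x : ℝ => (ρ x : ℂ)) := h.int.ofReal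
  have c2 : Integrable (fun x : ℝ => ζ / σ * ((x * ρ x : ℝ) : ℂ)) := h.i1.ofReal.const_mul _
  have c3 : Integrable (fun x : ℝ => (ζ / σ) ^ 2 / 2 * ((x ^ 2 * ρ x : ℝ) : ℂ)) :=
    h.i2.ofReal.const_mul _
  have c12 : Integrable (fun x : ℝ => (ρ x : ℂ) + ζ / σ * ((x * ρ x : ℝ) : ℂ)) := c1.add c2
  have c123 : Integrable (fun x : ℝ => (ρ x : ℂ) + ζ / σ * ((x * ρ x : ℝ) : ℂ) +
    (ζ / σ) ^ 2 / 2 * ((x ^ 2 * ρ x : ℝ) : ℂ)) := c12.add c3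
  have hmain : ∫ x : ℝ, ((ρ x : ℂ) + ζ / σ * ((x * ρ x : ℝ) : ℂ) +
      (ζ / σ) ^ 2 / 2 * ((x ^ 2 * ρ x : ℝ) : ℂ)) = 1 + ζ ^ 2 / (2 * σ ^ 2) := by
    rw [integral_add c12 c3, integral_add c1 c2, integral_const_mul, integral_const_mul,
      integral_complex_ofReal, integral_complex_ofReal, integral_complex_ofReal, h.mass, h.mean,
      h.var]
    push_cast; ring
  refine ⟨hIntg, ?_, ?_⟩
  · have e : lap f (ζ / σ) - 1 - ζ ^ 2 / (2 * σ ^ 2) = ∫ x : ℝ, ((f x : ℂ) * Complex.exp (ζ / σ * x)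
        - ρ x * (1 + ζ / σ * x + (ζ / σ * x) ^ 2 / 2)) := by
      rw [sub_sub, ← hmain, lap, ← integral_sub hIntg c123]
      congr 1; ext x; push_cast; ring
    rw [e]
    refine (norm_integral_le_of_norm_le (iB.mul_const _)
      (Filter.Eventually.of_forall fun x => (P x).2.1)).trans ?_
    rw [integral_mul_const, ← hKB]
    rw [← mul_div_assoc]
    refine div_le_div_of_nonneg_right ?_ (by positivity)
    have : 0 ≤ 1 + ‖ζ‖ ^ 3 := by positivity
    nlinarith
  · have hIntg2 := lap_integrable_im ρ h.int (t / σ)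
    have e : lap f (ζ / σ) - lap ρ (((t / σ : ℝ) : ℂ) * Complex.I) = ∫ x : ℝ, ((f x : ℂ) *
        Complex.exp (ζ / σ * x) - ρ x * Complex.exp (((t / σ : ℝ) : ℂ) * Complex.I * x)) := by
      rw [integral_sub hIntg hIntg2]; rfl
    have b : ‖lap f (ζ / σ) - lap ρ (((t / σ : ℝ) : ℂ) * Complex.I)‖ ≤ KC * ((1 + |r|) / σ) := by
      rw [e]
      refine (norm_integral_le_of_norm_le (iC.mul_const _)
        (Filter.Eventually.of_forall fun x => (P x).2.2)).trans ?_
      rw [integral_mul_const]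
    have b2 := norm_le_norm_add_norm_sub' (lap f (ζ / σ)) (lap ρ (((t / σ : ℝ) : ℂ) * Complex.I))
    have b3 : KC * ((1 + |r|) / σ) ≤ (4 * KB + KC + 1) * ((1 + |r|) / σ) := by
      gcongr; linarith
    linarith

lemma poly_exp1 (t : ℝ) : (1 + |t| ^ 3) * Real.exp (-(t ^ 2 / 4)) ≤ 426 / (1 + t ^ 2) := by
  rw [Real.exp_neg, ← div_eq_mul_inv, div_le_div_iff₀ (Real.exp_pos _) (by positivity)]
  have h1 := Real.pow_div_factorial_le_exp (t ^ 2 / 4) (by positivity) 3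
  have h2 := Real.pow_div_factorial_le_exp (t ^ 2 / 4) (by positivity) 2
  have h3 := Real.pow_div_factorial_le_exp (t ^ 2 / 4) (by positivity) 1
  have h4 : 1 ≤ Real.exp (t ^ 2 / 4) := Real.one_le_exp (by positivity)
  norm_num [Nat.factorial] at h1 h2 h3
  have h5 : |t| ^ 3 ≤ 1 + (t ^ 2) ^ 2 := by
    rw [← sq_abs t]
    nlinarith [mul_nonneg (sq_nonneg (|t|)) (sq_nonneg (|t| - 1)), sq_nonneg (|t|^2 - 1),
      sq_nonneg (|t| ^ 2), sq_nonneg (|t|-1)]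
  set w := t ^ 2
  have hw : 0 ≤ w := sq_nonneg t
  have : (1 + |t| ^ 3) * (1 + w) ≤ (2 + w ^ 2) * (1 + w) :=
    mul_le_mul_of_nonneg_right (by linarith) (by linarith)
  nlinarith

lemma poly_exp2 (t : ℝ) : Real.exp (-(t ^ 2 / 2)) * |t| ≤ 13 / (1 + t ^ 2) := by
  rw [Real.exp_neg, mul_comm, ← div_eq_mul_inv, div_le_div_iff₀ (Real.exp_pos _) (by positivity)]
  have h2 := Real.pow_div_factorial_le_exp (t ^ 2 / 2) (by positivity) 2
  have h3 := Real.pow_div_factorial_le_exp (t ^ 2 / 2) (by positivity) 1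
  have h4 : 1 ≤ Real.exp (t ^ 2 / 2) := Real.one_le_exp (by positivity)
  norm_num [Nat.factorial] at h2 h3
  have h5 : |t| ≤ 1 + (t ^ 2) := by
    rw [← sq_abs t]; nlinarith [sq_nonneg (|t| - 1)]
  set w := t ^ 2
  have hw : 0 ≤ w := sq_nonneg t
  have : |t| * (1 + w) ≤ (1 + w) * (1 + w) := by gcongr
  nlinarith

set_option maxHeartbeats 1000000 in
/-- small frequencies -/
lemma small_t (C0 σ r t : ℝ) (n : ℕ) (hn : 1 ≤ n) (α ζ : ℂ) (hC0 : 0 < C0) (hσ : 1 ≤ σ)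
    (hσn : σ ^ 2 = n)
    (hζ : ζ = r + t * Complex.I) (hα : ‖α - 1 - ζ ^ 2 / (2 * σ ^ 2)‖ ≤ C0 * (1 + ‖ζ‖ ^ 3) / σ ^ 3)
    (hr : |r| ≤ σ / 2) (hr3 : |r| ^ 3 ≤ σ) (ht : |t| ≤ σ / (32 * (C0 + 1))) :
    ‖α ^ n - Complex.exp (ζ ^ 2 / 2)‖ ≤
      (12 * (C0 + 1) * Real.exp (10 * (C0 + 1)) * 426) / σ * (1 + |r| ^ 3)
        * Real.exp (r ^ 2 / 2) / (1 + t ^ 2) := by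
  have hσ0 : 0 < σ := by linarith
  set C1 := C0 + 1 with hC1
  have hC1p : 1 ≤ C1 := by linarith
  have ht2 : |t| ≤ σ / 2 := ht.trans (by gcongr; linarith)
  set Z := ‖ζ‖ with hZ
  have hZ0 : 0 ≤ Z := norm_nonneg _
  have hZle : Z ≤ |r| + |t| := by
    rw [hZ, hζ]
    refine (norm_add_le _ _).trans ?_
    simp
  have hZσ : Z ≤ σ := by linarith
  have hZ3 : Z ^ 3 ≤ 4 * |r| ^ 3 + 4 * |t| ^ 3 := by
    have : Z ^ 3 ≤ (|r| + |t|) ^ 3 := by gcongr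
    have a := abs_nonneg r
    have b := abs_nonneg t
    nlinarith [mul_nonneg (add_nonneg a b) (sq_nonneg (|r| - |t|))]
  have hσc : (σ : ℂ) ≠ 0 := by exact_mod_cast hσ0.ne'
  set v : ℂ := ζ ^ 2 / (2 * σ ^ 2) with hv
  set β := Complex.exp v with hβ
  have hvn : ‖v‖ = Z ^ 2 / (2 * σ ^ 2) := by
    rw [hv, norm_div, norm_pow, norm_mul, norm_pow, Complex.norm_real, Real.norm_of_nonneg hσ0.le]
    simp [hZ]
  have hv1 : ‖v‖ ≤ 1 := by
    rw [hvn, div_le_one (by positivity)]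
    nlinarith
  have hβ1 : ‖β - 1 - v‖ ≤ (1 + Z ^ 3) / σ ^ 3 := by
    refine (Complex.norm_exp_sub_one_sub_id_le hv1).trans ?_
    rw [hvn, div_pow, div_le_div_iff₀ (by positivity) (by positivity)]
    have : (Z ^ 2) ^ 2 * σ ^ 3 ≤ Z ^ 3 * (2 * σ ^ 2) ^ 2 := by
      have : Z ^ 3 * σ ^ 3 * Z ≤ Z ^ 3 * σ ^ 3 * (4 * σ) := by gcongr; linarith
      nlinarith
    have : 0 ≤ (2 * σ ^ 2) ^ 2 := by positivity
    nlinarith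
  set δ := C1 * (1 + Z ^ 3) / σ ^ 3 with hδ
  have hδ0 : 0 ≤ δ := by positivity
  have hαβ : ‖α - β‖ ≤ δ := by
    have : α - β = (α - 1 - v) - (β - 1 - v) := by ring
    rw [this]
    refine (norm_sub_le _ _).trans ((add_le_add hα hβ1).trans (le_of_eq ?_))
    rw [hδ, hC1]; ring
  have hvre : v.re = (r ^ 2 - t ^ 2) / (2 * σ ^ 2) := by
    have : v = (((r ^ 2 - t ^ 2) / (2 * σ ^ 2) : ℝ) : ℂ) +
        ((2 * r * t / (2 * σ ^ 2) : ℝ) : ℂ) * Complex.I := by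
      rw [hv, hζ]; push_cast
      have : ((r : ℂ) + t * Complex.I) ^ 2 = r ^ 2 - t ^ 2 + 2 * r * t * Complex.I := by
        ring_nf; rw [Complex.I_sq]; ring
      rw [this]; ring
    rw [this]; simp only [Complex.add_re, Complex.re_ofReal_mul, Complex.ofReal_re, Complex.I_re,
      mul_zero, add_zero]
  have hβn : ‖β‖ = Real.exp ((r ^ 2 - t ^ 2) / (2 * σ ^ 2)) := by
    rw [hβ, Complex.norm_exp, hvre]
  have htσ : t ^ 2 ≤ σ ^ 2 / 4 := by
    rw [← sq_abs]; nlinarith [abs_nonneg t]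
  have hβlow : 1 / 2 ≤ ‖β‖ := by
    rw [hβn]
    have h1 : -(1 / 2) ≤ (r ^ 2 - t ^ 2) / (2 * σ ^ 2) := by
      rw [le_div_iff₀ (by positivity)]; nlinarith [sq_nonneg r]
    have := Real.add_one_le_exp ((r ^ 2 - t ^ 2) / (2 * σ ^ 2))
    linarith
  set E := Real.exp ((r ^ 2 / 2 - t ^ 2 / 4 + 10 * C1) / σ ^ 2) with hE
  have hδσ : σ ^ 2 * (2 * δ) ≤ 10 * C1 + t ^ 2 / 4 := by
    have e : σ ^ 2 * (2 * δ) = 2 * C1 * (1 + Z ^ 3) / σ := by rw [hδ]; field_simp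
    rw [e, div_le_iff₀ hσ0]
    have h1 : |t| ^ 3 ≤ t ^ 2 * (σ / (32 * C1)) := by
      rw [pow_succ, sq_abs]; gcongr
    have h2 : 2 * C1 * (4 * |t| ^ 3) ≤ t ^ 2 / 4 * σ := by
      calc 2 * C1 * (4 * |t| ^ 3) ≤ 2 * C1 * (4 * (t ^ 2 * (σ / (32 * C1)))) := by gcongr
        _ = _ := by field_simp; ring
    nlinarith
  have hδe : 2 * δ ≤ (10 * C1 + t ^ 2 / 4) / σ ^ 2 := by
    rw [le_div_iff₀ (by positivity)]; linarith
  have hαE : ‖α‖ ≤ E := by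
    have h1 : ‖α‖ ≤ ‖β‖ + ‖α - β‖ := norm_le_norm_add_norm_sub' α β
    have h2 : ‖α‖ ≤ ‖β‖ * (2 * δ + 1) := by nlinarith
    refine h2.trans ?_
    calc ‖β‖ * (2 * δ + 1) ≤ ‖β‖ * Real.exp (2 * δ) := by
          gcongr; exact Real.add_one_le_exp _
      _ ≤ E := by
          rw [hβn, ← Real.exp_add, hE]
          apply Real.exp_le_exp.2
          have : (r ^ 2 - t ^ 2) / (2 * σ ^ 2) + (10 * C1 + t ^ 2 / 4) / σ ^ 2
            = (r ^ 2 / 2 - t ^ 2 / 4 + 10 * C1) / σ ^ 2 := by field_simp; ring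
          linarith
  have hβE : ‖β‖ ≤ E := by
    rw [hβn, hE]
    apply Real.exp_le_exp.2
    rw [div_le_div_iff₀ (by positivity) (by positivity)]
    have : 0 < σ ^ 2 := by positivity
    nlinarith [mul_nonneg this.le (sq_nonneg t)]
  obtain ⟨m, rfl⟩ : ∃ m, n = m + 1 := ⟨n - 1, by omega⟩
  have hpd := pow_diff α β E hαE hβE m
  have hβpow : β ^ (m + 1) = Complex.exp (ζ ^ 2 / 2) := by
    rw [hβ, ← Complex.exp_nat_mul, ← Complex.ofReal_natCast, ← hσn, hv]
    congr 1; push_cast; field_simp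
  rw [hβpow] at hpd
  have hEpos : 0 < E := Real.exp_pos _
  have hEinv : 1 ≤ 3 * E := by
    have h1 : -(1 / 2) ≤ (r ^ 2 / 2 - t ^ 2 / 4 + 10 * C1) / σ ^ 2 := by
      rw [le_div_iff₀ (by positivity)]; nlinarith [sq_nonneg r]
    have := Real.add_one_le_exp ((r ^ 2 / 2 - t ^ 2 / 4 + 10 * C1) / σ ^ 2)
    rw [hE]; linarith
  have hEn : E ^ (m + 1) = Real.exp (r ^ 2 / 2 - t ^ 2 / 4 + 10 * C1) := by
    rw [hE, ← Real.exp_nat_mul, ← hσn]; congr 1; field_simp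
  have hEm : E ^ m ≤ 3 * Real.exp (r ^ 2 / 2 - t ^ 2 / 4 + 10 * C1) := by
    rw [← hEn, pow_succ]
    have : 0 ≤ E ^ m := by positivity
    nlinarith
  have hm1 : ((m : ℝ) + 1) = σ ^ 2 := by rw [hσn]; push_cast; ring
  refine hpd.trans ?_
  rw [hm1]
  have hexp : Real.exp (r ^ 2 / 2 - t ^ 2 / 4 + 10 * C1) = Real.exp (r ^ 2 / 2) *
      Real.exp (-(t ^ 2 / 4)) * Real.exp (10 * C1) := by
    rw [← Real.exp_add, ← Real.exp_add]; congr 1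
  have hZr : 1 + Z ^ 3 ≤ 4 * (1 + |r| ^ 3) * (1 + |t| ^ 3) := by
    have a : 0 ≤ |r| ^ 3 := by positivity
    have b : 0 ≤ |t| ^ 3 := by positivity
    nlinarith [mul_nonneg a b]
  calc σ ^ 2 * ‖α - β‖ * E ^ m ≤ σ ^ 2 * δ * (3 * Real.exp (r ^ 2 / 2 - t ^ 2 / 4 + 10 * C1)) := by
        gcongr
    _ = 3 * C1 / σ * (1 + Z ^ 3) * (Real.exp (r ^ 2 / 2) *
      Real.exp (-(t ^ 2 / 4)) * Real.exp (10 * C1)) := by rw [hexp, hδ]; field_simp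
    _ ≤ 3 * C1 / σ * (4 * (1 + |r| ^ 3) * (1 + |t| ^ 3)) * (Real.exp (r ^ 2 / 2) *
      Real.exp (-(t ^ 2 / 4)) * Real.exp (10 * C1)) := by gcongr
    _ = 12 * C1 * Real.exp (10 * C1) / σ * (1 + |r| ^ 3) * Real.exp (r ^ 2 / 2) *
        ((1 + |t| ^ 3) * Real.exp (-(t ^ 2 / 4))) := by ring
    _ ≤ 12 * C1 * Real.exp (10 * C1) / σ * (1 + |r| ^ 3) * Real.exp (r ^ 2 / 2) *
        (426 / (1 + t ^ 2)) := by gcongr; exact poly_exp1 t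
    _ = _ := by ring

lemma q_pow_bound (q : ℝ) (h0 : 0 ≤ q) (h1 : q < 1) :
    ∃ Q > 0, ∀ n : ℕ, 2 ≤ n → q ^ (n - 2) * (n : ℝ) ^ 3 ≤ Q := by
  have h := tendsto_pow_const_mul_const_pow_of_lt_one 3 h0 h1
  have h2 := (h.bddAbove_range)
  have h' : Filter.Tendsto (fun n : ℕ => ((n : ℝ) + 2) ^ 3 * q ^ n) Filter.atTop (nhds 0) := by
    have a := fun k => tendsto_pow_const_mul_const_pow_of_lt_one k h0 h1
    have := ((a 3).add ((a 2).const_mul 6)).add (((a 1).const_mul 12).add ((a 0).const_mul 8))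
    simp only [mul_zero, add_zero] at this
    refine this.congr fun n => ?_
    ring
  obtain ⟨Q, hQ⟩ := h'.bddAbove_range
  refine ⟨max Q 1, by positivity, fun n hn => ?_⟩
  obtain ⟨m, rfl⟩ : ∃ m, n = m + 2 := ⟨n - 2, by omega⟩
  have := hQ ⟨m, rfl⟩
  refine le_trans ?_ (this.trans (le_max_left _ _))
  rw [Nat.add_sub_cancel]; push_cast; rw [mul_comm]

/-- large frequencies -/
lemma big_t (W σ r t ε q Q : ℝ) (n : ℕ) (hn : 2 ≤ n) (α ζ : ℂ) (hε : 0 < ε) (hσ : 1 ≤ σ)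
    (hσn : σ ^ 2 = n) (hW : 0 < W) (hQ0 : 0 < Q)
    (hζ : ζ = r + t * Complex.I) (hq : ‖α‖ ≤ q) (hQ : q ^ (n - 2) * (n : ℝ) ^ 3 ≤ Q)
    (ht : ε * σ ≤ |t|) (ht1 : 1 ≤ |t|) (hdec : ‖α‖ ≤ W * n / |t|) :
    ‖α ^ n - Complex.exp (ζ ^ 2 / 2)‖ ≤
      (2 * W ^ 2 * Q + 13 / ε) / σ * (1 + |r| ^ 3) * Real.exp (r ^ 2 / 2) / (1 + t ^ 2) := by
  have hσ0 : 0 < σ := by linarith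
  have ht0 : 0 < |t| := by linarith
  have hq0 : 0 ≤ q := (norm_nonneg _).trans hq
  have hnR : (n : ℝ) = σ ^ 2 := hσn.symm
  have htt : 1 + t ^ 2 ≤ 2 * t ^ 2 := by rw [← sq_abs]; nlinarith
  have htp : 0 < t ^ 2 := by rw [← sq_abs]; positivity
  have b1 : ‖α ^ n‖ ≤ 2 * W ^ 2 * Q / σ / (1 + t ^ 2) := by
    obtain ⟨m, rfl⟩ : ∃ m, n = m + 2 := ⟨n - 2, by omega⟩
    rw [Nat.add_sub_cancel] at hQ
    rw [norm_pow, pow_add]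
    have hQ' : q ^ m * ((m + 2 : ℕ) : ℝ) ^ 2 ≤ Q / σ := by
      rw [le_div_iff₀ hσ0]
      refine le_trans ?_ hQ
      rw [hnR]
      have : σ ≤ σ ^ 2 := by nlinarith
      calc q ^ m * (σ ^ 2) ^ 2 * σ ≤ q ^ m * (σ ^ 2) ^ 2 * σ ^ 2 := by gcongr
        _ = _ := by ring
    calc ‖α‖ ^ m * ‖α‖ ^ 2 ≤ q ^ m * (W * ((m + 2 : ℕ) : ℝ) / |t|) ^ 2 := by gcongr
      _ = (q ^ m * ((m + 2 : ℕ) : ℝ) ^ 2) * W ^ 2 / t ^ 2 := by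
          rw [div_pow, sq_abs]; ring
      _ ≤ (Q / σ) * W ^ 2 / t ^ 2 := by gcongr
      _ ≤ _ := by
          rw [div_le_div_iff₀ htp (by positivity)]
          have : 0 ≤ Q / σ * W ^ 2 := by positivity
          calc Q / σ * W ^ 2 * (1 + t ^ 2) ≤ Q / σ * W ^ 2 * (2 * t ^ 2) := by gcongr
            _ = _ := by ring
  have hre : (ζ ^ 2 / 2).re = r ^ 2 / 2 - t ^ 2 / 2 := by
    have : ζ ^ 2 / 2 = ((r ^ 2 / 2 - t ^ 2 / 2 : ℝ) : ℂ) + ((r * t : ℝ) : ℂ) * Complex.I := by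
      rw [hζ]; push_cast
      have : ((r : ℂ) + t * Complex.I) ^ 2 = r ^ 2 - t ^ 2 + 2 * r * t * Complex.I := by
        ring_nf; rw [Complex.I_sq]; ring
      rw [this]; ring
    rw [this]; simp only [Complex.add_re, Complex.re_ofReal_mul, Complex.ofReal_re, Complex.I_re,
      mul_zero, add_zero]
  have b2 : ‖Complex.exp (ζ ^ 2 / 2)‖ ≤ 13 / ε / σ * Real.exp (r ^ 2 / 2) / (1 + t ^ 2) := by
    rw [Complex.norm_exp, hre, show r ^ 2 / 2 - t ^ 2 / 2 = r ^ 2 / 2 + -(t ^ 2 / 2) by ring,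
      Real.exp_add]
    have h1 := poly_exp2 t
    have h2 : Real.exp (-(t ^ 2 / 2)) ≤ 13 / (1 + t ^ 2) / (ε * σ) := by
      rw [le_div_iff₀ (by positivity)]
      refine le_trans ?_ h1
      gcongr
    calc _ ≤ Real.exp (r ^ 2 / 2) * (13 / (1 + t ^ 2) / (ε * σ)) := by gcongr
      _ = _ := by field_simp
  have hr1 : 1 ≤ Real.exp (r ^ 2 / 2) := Real.one_le_exp (by positivity)
  have hr2 : 1 ≤ 1 + |r| ^ 3 := by have : 0 ≤ |r| ^ 3 := by positivity
                                   linarith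
  refine (norm_sub_le _ _).trans ((add_le_add b1 b2).trans ?_)
  calc _ ≤ 2 * W ^ 2 * Q / σ / (1 + t ^ 2) * ((1 + |r| ^ 3) * Real.exp (r ^ 2 / 2))
        + 13 / ε / σ * Real.exp (r ^ 2 / 2) / (1 + t ^ 2) * (1 + |r| ^ 3) := by
        gcongr
        · exact le_mul_of_one_le_right (by positivity) (one_le_mul_of_one_le_of_one_le hr2 hr1)
        · exact le_mul_of_one_le_right (by positivity) hr2
    _ = _ := by ring

theorem key {ρ : ℝ → ℝ} {W : ℝ} (h : GoodDens ρ W) :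
    ∃ C > 0, ∃ η > 0, ∃ n0 : ℕ, ∀ n : ℕ, n0 ≤ n → ∀ (f : ℝ → ℝ) (r : ℝ), Adm ρ f r (√n) →
      (1 + |r|) * Real.exp |r| ≤ η * √n →
      (∀ t : ℝ, t ≠ 0 → ‖lap f ((r + t * Complex.I) / (√n : ℝ))‖ ≤ W * n / |t|) →
      ∀ t : ℝ, Integrable (fun x : ℝ => (f x : ℂ) *
          Complex.exp ((r + t * Complex.I) / (√n : ℝ) * x)) ∧
        ‖lap f ((r + t * Complex.I) / (√n : ℝ)) ^ n - Complex.exp ((r + t * Complex.I) ^ 2 / 2)‖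
        ≤ C / √n * (1 + |r| ^ 3) * Real.exp (r ^ 2 / 2) / (1 + t ^ 2) := by
  obtain ⟨C0, hC0, hB⟩ := lapB_int h
  set ε := 1 / (32 * (C0 + 1)) with hε
  have hε0 : 0 < ε := by positivity
  obtain ⟨q0, hq01, hq00, hq0⟩ := lap_q ρ h.pos h.int h.mass W h.W0
    (fun t ht => lap_decay ρ h.int W h.decay t ht) ε hε0
  obtain ⟨Q, hQ0, hQ⟩ := q_pow_bound ((1 + q0) / 2) (by linarith) (by linarith)
  set CS := 12 * (C0 + 1) * Real.exp (10 * (C0 + 1)) * 426 with hCS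
  set CB := 2 * W ^ 2 * Q + 13 / ε with hCB
  have hW0 := h.W0
  have hCS0 : 0 < CS := by positivity
  have hCB0 : 0 < CB := by positivity
  set η := min (1 / 2) ((1 - q0) / 2 / C0) with hη
  have hη0 : 0 < η := lt_min (by norm_num) (div_pos (by linarith) hC0)
  obtain ⟨n1, hn1⟩ := exists_nat_gt ((1 / ε) ^ 2)
  refine ⟨CS + CB, by positivity, η, hη0, max 2 n1, ?_⟩
  intro n hn f r hf hr hdec t
  have hn2 : 2 ≤ n := (le_max_left _ _).trans hn
  have hnn1 : (n1 : ℝ) ≤ n := by exact_mod_cast (le_max_right _ _).trans hn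
  set σ := √(n : ℝ) with hσ
  have hσn : σ ^ 2 = n := Real.sq_sqrt (by positivity)
  have hσ1 : 1 ≤ σ := by
    rw [hσ]; apply Real.one_le_sqrt.2; exact_mod_cast (by omega : 1 ≤ n)
  have hσ0 : 0 < σ := by linarith
  have hεσ : 1 ≤ ε * σ := by
    have : 1 / ε ≤ σ := by
      apply Real.le_sqrt_of_sq_le; linarith
    rwa [div_le_iff₀ hε0, mul_comm] at this
  obtain ⟨hi, h1, h2⟩ := hB f r σ hσ1 hf t _ rfl
  refine ⟨hi, ?_⟩
  have hra := abs_nonneg r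
  have hexp1 : 1 ≤ Real.exp |r| := Real.one_le_exp hra
  have hr1 : 1 + |r| ≤ η * σ := by nlinarith
  have hη2 : η ≤ 1 / 2 := min_le_left _ _
  have hηq : η * C0 ≤ (1 - q0) / 2 := by
    have := min_le_right (1 / 2) ((1 - q0) / 2 / C0)
    rwa [le_div_iff₀ hC0] at this
  have hησ : η * σ ≤ σ / 2 := by nlinarith
  by_cases ht : |t| ≤ σ / (32 * (C0 + 1))
  · refine (small_t C0 σ r t n (by omega) _ _ hC0 hσ1 hσn rfl h1 (by linarith) ?_ ht).trans ?_
    · have := Real.pow_div_factorial_le_exp |r| hra 2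
      norm_num [Nat.factorial] at this
      have h3 : (1 + |r|) * (|r| ^ 2 / 2) ≤ σ / 2 := by
        refine le_trans ?_ (hr.trans hησ)
        gcongr
        simpa using this
      nlinarith [sq_nonneg (|r|)]
    · rw [← hCS]
      have : CS ≤ CS + CB := by linarith
      gcongr
  · push Not at ht
    have hte : ε * σ ≤ |t| := by
      have : σ / (32 * (C0 + 1)) = ε * σ := by rw [hε]; ring
      linarith
    have ht0 : t ≠ 0 := abs_pos.1 (by linarith)
    refine (big_t W σ r t ε ((1 + q0) / 2) Q n hn2 _ _ hε0 hσ1 hσn h.W0 hQ0 rfl ?_ (hQ n hn2) hte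
      (by linarith) (hdec t ht0)).trans ?_
    · refine h2.trans ?_
      have h3 := hq0 (t / σ) (by rw [abs_div, abs_of_pos hσ0, le_div_iff₀ hσ0]; exact hte)
      have h4 : C0 * ((1 + |r|) / σ) ≤ (1 - q0) / 2 := by
        rw [← mul_div_assoc, div_le_iff₀ hσ0]
        nlinarith
      linarith
    · rw [← hCB]
      have : CB ≤ CS + CB := by linarith
      gcongr


open scoped FourierTransform in
lemma inv_bound (H : ℝ → ℂ) (hc : Continuous H) (hi : Integrable H) (K : ℝ)
    (hK : ∀ t : ℝ, ‖∫ x : ℝ, H x * Complex.exp ((t * Complex.I) * x)‖ ≤ K / (1 + t ^ 2)) :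
    ∀ x, ‖H x‖ ≤ K := by
  have hK0 : 0 ≤ K := by simpa using (norm_nonneg _).trans (hK 0)
  have hcF : Continuous (𝓕 H) := 
    VectorFourier.fourierIntegral_continuous Real.continuous_fourierChar
      (by exact continuous_inner) hi
  have hb2 : ∀ w : ℝ, ‖𝓕 H w‖ ≤ K * (1 + (2 * π * w) ^ 2)⁻¹ := by
    intro w
    rw [Real.fourier_real_eq_integral_exp_smul]
    have e : ∫ v : ℝ, Complex.exp (↑(-2 * π * v * w) * Complex.I) • H v =
        ∫ x : ℝ, H x * Complex.exp (((-2 * π * w : ℝ) * Complex.I) * x) := by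
      congr 1; ext v; rw [smul_eq_mul, mul_comm]; congr 2; push_cast; ring
    rw [e]
    refine (hK _).trans (le_of_eq ?_)
    rw [div_eq_mul_inv]; congr 2; ring
  have hi2 : Integrable fun w : ℝ => (1 + (2 * π * w) ^ 2)⁻¹ :=
    integrable_inv_one_add_sq.comp_mul_left' (by positivity)
  have hiF : Integrable (𝓕 H) :=
    (hi2.const_mul K).mono' hcF.aestronglyMeasurable (Filter.Eventually.of_forall hb2)
  intro x
  have hinv := congrFun (hc.fourierInv_fourier_eq hi hiF) x
  rw [← hinv, Real.fourierInv_eq']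
  refine (norm_integral_le_of_norm_le (hi2.const_mul K)
    (Filter.Eventually.of_forall fun w => ?_)).trans ?_
  · rw [norm_smul, Complex.norm_exp_ofReal_mul_I, one_mul]; exact hb2 w
  · rw [integral_const_mul, Measure.integral_comp_mul_left (fun w : ℝ => (1 + w ^ 2)⁻¹) (2 * π),
      integral_univ_inv_one_add_sq, abs_of_pos (by positivity), smul_eq_mul]
    have : (2 * π)⁻¹ * π = 1 / 2 := by field_simp
    rw [this]; linarith

lemma gauss_lap (z : ℂ) : Integrable (fun x : ℝ => (gaussPDF x : ℂ) * Complex.exp (z * x)) ∧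
    ∫ x : ℝ, (gaussPDF x : ℂ) * Complex.exp (z * x) = Complex.exp (z ^ 2 / 2) := by
  have e : ∀ x : ℝ, (gaussPDF x : ℂ) = (ProbabilityTheory.gaussianPDFReal 0 1 x : ℂ) := by
    intro x; congr 1; simp [gaussPDF, ProbabilityTheory.gaussianPDFReal]
  constructor
  · have := (integrable_cexp_quadratic (b := 1 / 2) (by norm_num) z 0).const_mul
      ((Real.sqrt (2 * π))⁻¹ : ℂ)
    refine this.congr (Filter.Eventually.of_forall fun x => ?_)
    simp only [gaussPDF]
    push_cast
    rw [mul_assoc, ← Complex.exp_add]; congr 2; ring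
  · have := ProbabilityTheory.complexMGF_id_gaussianReal (μ := 0) (v := 1) z
    rw [ProbabilityTheory.complexMGF,
      ProbabilityTheory.integral_gaussianReal_eq_integral_smul one_ne_zero] at this
    simp only [Complex.real_smul, id] at this
    simp only [e, this]
    congr 1; simp

lemma gauss_cont : Continuous gaussPDF := by unfold gaussPDF; fun_prop
lemma gauss_pos (x : ℝ) : 0 < gaussPDF x := by unfold gaussPDF; positivity

lemma gauss_int : Integrable gaussPDF := by
  have := (gauss_lap 0).1
  simp only [zero_mul, Complex.exp_zero, mul_one] at this
  exact_mod_cast this.re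

lemma gauss_mass : ∫ x, gaussPDF x = 1 := by
  have := (gauss_lap 0).2
  simp only [zero_mul, Complex.exp_zero, mul_one] at this
  rw [integral_complex_ofReal] at this
  have h2 : ((∫ x, gaussPDF x : ℝ) : ℂ) = ((1 : ℝ) : ℂ) := by rw [this]; simp
  exact_mod_cast h2

lemma resc_lap (f : ℝ → ℝ) (n : ℕ) (hn : 1 ≤ n) (z : ℂ)
    (hf : Integrable (fun x : ℝ => (f x : ℂ) * Complex.exp (z / (√n : ℝ) * x))) :
    Integrable (fun x : ℝ => (rescaledConv f n x : ℂ) * Complex.exp (z * x)) ∧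
    ∫ x : ℝ, (rescaledConv f n x : ℂ) * Complex.exp (z * x) = lap f (z / (√n : ℝ)) ^ n := by
  obtain ⟨h1, h2⟩ := lap_iter hf (n - 1)
  have hσ : 0 < √(n : ℝ) := Real.sqrt_pos.2 (by exact_mod_cast hn)
  have hσc : ((√(n : ℝ) : ℝ) : ℂ) ≠ 0 := by exact_mod_cast hσ.ne'
  have e : ∀ x : ℝ, (rescaledConv f n x : ℂ) * Complex.exp (z * x) = ((√(n : ℝ) : ℝ) : ℂ) *
      ((fun y : ℝ => (iterConv f (n - 1) y : ℂ) * Complex.exp (z / (√n : ℝ) * y)) (√n * x)) := by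
    intro x
    simp only [rescaledConv]
    push_cast
    rw [mul_assoc]; congr 3
    field_simp
  constructor
  · simp only [e]
    exact (h1.comp_mul_left' hσ.ne').const_mul _
  · rw [integral_congr_ae (Filter.Eventually.of_forall e)]
    rw [integral_const_mul, Measure.integral_comp_mul_left (fun y : ℝ =>
      (iterConv f (n - 1) y : ℂ) * Complex.exp (z / (√n : ℝ) * y)), abs_of_pos (by positivity),
      Complex.real_smul, ← mul_assoc]
    push_cast
    rw [mul_inv_cancel₀ hσc, one_mul]
    rw [show n - 1 + 1 = n by omega] at h2
    exact h2

theorem star {ρ : ℝ → ℝ} {W : ℝ} (h : GoodDens ρ W) :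
    ∃ C > 0, ∃ η > 0, ∃ n0 : ℕ, 2 ≤ n0 ∧ ∀ n : ℕ, n0 ≤ n → ∀ (f : ℝ → ℝ) (r : ℝ),
      Adm ρ f r (√n) →
      (1 + |r|) * Real.exp |r| ≤ η * √n →
      (∀ t : ℝ, t ≠ 0 → ‖lap f ((r + t * Complex.I) / (√n : ℝ))‖ ≤ W * n / |t|) →
      Continuous (iterConv f (n - 1)) →
      ∀ x : ℝ, |rescaledConv f n x - gaussPDF x| ≤
        C / √n * (1 + |r| ^ 3) * Real.exp (r ^ 2 / 2 - r * x) := by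
  obtain ⟨C, hC, η, hη, n0, hk⟩ := key h
  refine ⟨C, hC, η, hη, max 2 n0, le_max_left _ _, ?_⟩
  intro n hn f r hf hr hdec hcont x
  have hk := hk n ((le_max_right _ _).trans hn) f r hf hr hdec
  have hn1 : 1 ≤ n := by have := (le_max_left 2 n0).trans hn; omega
  set H : ℝ → ℂ := fun x => ((rescaledConv f n x : ℂ) - gaussPDF x) * Complex.exp (r * x) with hH
  have hHt : ∀ t x : ℝ, H x * Complex.exp ((t * Complex.I) * x) =
      (rescaledConv f n x : ℂ) * Complex.exp ((r + t * Complex.I) * x) -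
      gaussPDF x * Complex.exp ((r + t * Complex.I) * x) := by
    intro t x
    simp only [hH]
    rw [add_mul, Complex.exp_add]; ring
  have hR := fun t : ℝ => resc_lap f n hn1 (r + t * Complex.I) (hk t).1
  have hHc : Continuous H := by
    have h1 : Continuous (rescaledConv f n) := by unfold rescaledConv; fun_prop
    have h2 := gauss_cont
    fun_prop
  have hHi : Integrable H := by
    have := (hR 0).1.sub (gauss_lap (r + (0 : ℝ) * Complex.I)).1
    refine this.congr (Filter.Eventually.of_forall fun x => ?_)
    have := hHt 0 x
    simp only [Pi.sub_apply, ← this]; simp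
  have hfin := inv_bound H hHc hHi (C / √n * (1 + |r| ^ 3) * Real.exp (r ^ 2 / 2)) (fun t => by
    simp only [hHt]
    rw [integral_sub (hR t).1 (gauss_lap _).1, (hR t).2, (gauss_lap _).2]
    exact (hk t).2) x
  rw [hH] at hfin
  simp only [norm_mul] at hfin
  rw [← Complex.ofReal_sub, Complex.norm_real, Real.norm_eq_abs, ← Complex.ofReal_mul,
    Complex.norm_exp_ofReal] at hfin
  rw [Real.exp_sub, ← mul_div_assoc, le_div_iff₀ (Real.exp_pos _)]
  exact hfin


/-- Truncated density. -/
def trunc (ρ : ℝ → ℝ) (n : ℕ) : ℝ → ℝ := (Icc (-√(n : ℝ)) (√(n : ℝ))).indicator ρ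

/-- The cut-off. -/
def cutT (n : ℕ) : ℝ := 2 * √(Real.log n)

lemma cutT_sq (n : ℕ) (hn : 1 ≤ n) : Real.exp (cutT n ^ 2 / 2) = (n : ℝ) ^ 2 := by
  have h1 : (1 : ℝ) ≤ n := by exact_mod_cast hn
  rw [cutT, mul_pow, Real.sq_sqrt (Real.log_nonneg h1),
    show (2 : ℝ) ^ 2 * Real.log n / 2 = (2 : ℕ) * Real.log n by push_cast; ring, Real.exp_nat_mul,
    Real.exp_log (by linarith)]

lemma cutT_large (η : ℝ) (hη : 0 < η) : ∃ n0 : ℕ, ∀ n : ℕ, n0 ≤ n →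
    2 ≤ cutT n ∧ (1 + cutT n) * Real.exp (cutT n) ≤ η * √n := by
  have ht : Filter.Tendsto cutT Filter.atTop Filter.atTop :=
    (Real.tendsto_sqrt_atTop.comp (Real.tendsto_log_atTop.comp
      tendsto_natCast_atTop_atTop)).const_mul_atTop (by norm_num : (0 : ℝ) < 2)
  set K := 8 * (2 + |Real.log η|) with hK
  obtain ⟨n0, h0⟩ := Filter.eventually_atTop.1 (ht.eventually_ge_atTop K)
  refine ⟨max 1 n0, fun n hn => ?_⟩
  have h1 := h0 n ((le_max_right _ _).trans hn)
  have hn1 : 1 ≤ n := (le_max_left _ _).trans hn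
  have ha := abs_nonneg (Real.log η)
  set T := cutT n with hT
  have hT2 : 16 ≤ T := by linarith
  refine ⟨by linarith, ?_⟩
  have hs : √(n : ℝ) = Real.exp (T ^ 2 / 8) := by
    have h2 := cutT_sq n hn1
    rw [Real.sqrt_eq_iff_mul_self_eq (by positivity) (by positivity), ← Real.exp_add]
    have h3 : (Real.exp (T ^ 2 / 8 + T ^ 2 / 8)) ^ 2 = (n : ℝ) ^ 2 := by
      rw [← h2, ← Real.exp_nat_mul]; congr 1; push_cast; ring
    exact (pow_left_inj₀ (by positivity) (by positivity) two_ne_zero).1 h3.symm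
  have hη1 : η = Real.exp (Real.log η) := (Real.exp_log hη).symm
  rw [hs]
  calc (1 + T) * Real.exp T ≤ Real.exp T * Real.exp T := by
        gcongr; have := Real.add_one_le_exp T; linarith
    _ ≤ Real.exp (Real.log η) * Real.exp (T ^ 2 / 8) := by
        rw [← Real.exp_add, ← Real.exp_add]
        apply Real.exp_le_exp.2
        have := neg_abs_le (Real.log η)
        nlinarith
    _ = _ := by rw [← hη1]

section
variable {ρ : ℝ → ℝ} {W : ℝ}

lemma trunc_meas (h : GoodDens ρ W) (n : ℕ) : Measurable (trunc ρ n) :=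
  h.meas.indicator measurableSet_Icc

lemma trunc_pos (h : GoodDens ρ W) (n : ℕ) (x : ℝ) : 0 ≤ trunc ρ n x :=
  indicator_nonneg (fun y _ => h.pos y) x

lemma trunc_le (h : GoodDens ρ W) (n : ℕ) (x : ℝ) : trunc ρ n x ≤ ρ x :=
  indicator_le_self' (fun y _ => h.pos y) x

lemma trunc_int (h : GoodDens ρ W) (n : ℕ) : Integrable (trunc ρ n) :=
  h.int.indicator measurableSet_Icc

lemma trunc_mass (h : GoodDens ρ W) (n : ℕ) : ∫ x, trunc ρ n x ≤ 1 := by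
  rw [← h.mass]; exact integral_mono (trunc_int h n) h.int (trunc_le h n)

lemma trunc_adm (h : GoodDens ρ W) (n : ℕ) (hn : 1 ≤ n) (r : ℝ)
    (hr : (1 + |r|) * Real.exp |r| ≤ √n) : Adm ρ (trunc ρ n) r (√n) where
  meas := trunc_meas h n
  pos := trunc_pos h n
  le := trunc_le h n
  eq := fun x hx => indicator_of_mem (s := Icc (-√(n : ℝ)) (√(n : ℝ))) (abs_le.1 hx) ρ
  supp := fun x hx => by
    have hσ : 0 < √(n : ℝ) := Real.sqrt_pos.2 (by exact_mod_cast hn)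
    have hx' : |x| ≤ √n := abs_le.2 (by
      by_contra hc; exact hx (indicator_of_notMem (s := Icc (-√(n : ℝ)) (√(n : ℝ))) hc ρ))
    have hx0 := abs_nonneg x
    have hr0 := abs_nonneg r
    by_cases hc : |r| * |x| ≤ √n
    · have : |r| * |x| / √n ≤ 1 := (div_le_one hσ).2 hc
      have h2 := Real.exp_le_exp.2 this
      have := Real.exp_one_lt_d9
      linarith
    · push Not at hc
      have h1 : |r| * |x| / √n ≤ |r| := by
        rw [div_le_iff₀ hσ]; gcongr
      have h2 := Real.exp_le_exp.2 h1
      have h3 : Real.exp |r| ≤ |x| := by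
        by_contra hcc
        push Not at hcc
        nlinarith
      linarith

lemma trunc_decay (h : GoodDens ρ W) (n : ℕ) (hn : 1 ≤ n) (r : ℝ)
    (hr : (1 + |r|) * Real.exp |r| ≤ √n) (t : ℝ) (ht : t ≠ 0) :
    ‖lap (trunc ρ n) ((r + t * Complex.I) / (√n : ℝ))‖ ≤ W * n / |t| := by
  have hσ : 0 < √(n : ℝ) := Real.sqrt_pos.2 (by exact_mod_cast hn)
  have hσ2 : √(n : ℝ) * √n = n := Real.mul_self_sqrt (by positivity)
  have hd := h.decay (√n) (r / √n) (t / √n) hσ.le (by positivity)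
  rw [trunc, lap_trunc _ _ hσ.le]
  have e : ((r : ℂ) + t * Complex.I) / (√n : ℝ) = ((r / √n : ℝ) : ℂ) + ((t / √n : ℝ) : ℂ) * Complex.I := by
    push_cast; ring
  rw [e]
  refine hd.trans ?_
  have hW := h.W0
  rw [abs_div, abs_div, abs_of_pos hσ, div_mul_cancel₀ _ hσ.ne', div_div_eq_mul_div]
  have h2 : Real.exp |r| ≤ √n := by
    have := abs_nonneg r
    have := Real.exp_pos |r|
    nlinarith
  have : W * Real.exp |r| * √n ≤ W * n := by
    calc W * Real.exp |r| * √n ≤ W * √n * √n := by gcongr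
      _ = _ := by rw [mul_assoc, hσ2]
  gcongr

lemma trunc_cont (h : GoodDens ρ W) (n : ℕ) (hn : 2 ≤ n) : Continuous (iterConv (trunc ρ n) (n - 1)) := by
  obtain ⟨m, rfl⟩ : ∃ m, n = m + 2 := ⟨n - 2, by omega⟩
  set σ := √((m + 2 : ℕ) : ℝ) with hσ
  refine iterConv_cont (M := W) (trunc_meas h _) (trunc_pos h _) (fun x => (trunc_le h _ x).trans
    (h.bdd x)) (trunc_int h _) (trunc_mass h _) (S := {-σ, σ}) (Set.toFinite _).countable ?_ m
  intro x hx
  simp only [mem_insert_iff, mem_singleton_iff, not_or] at hx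
  by_cases hxm : x ∈ Icc (-σ) σ
  · have : Icc (-σ) σ ∈ nhds x := Icc_mem_nhds (lt_of_le_of_ne hxm.1 (Ne.symm hx.1))
      (lt_of_le_of_ne hxm.2 hx.2)
    refine h.cont.continuousAt.congr ?_
    filter_upwards [this] with y hy
    exact (indicator_of_mem hy ρ).symm
  · have : (Icc (-σ) σ)ᶜ ∈ nhds x := isClosed_Icc.isOpen_compl.mem_nhds hxm
    refine (continuousAt_const (y := (0 : ℝ))).congr ?_
    filter_upwards [this] with y hy
    exact (indicator_of_notMem hy ρ).symm

lemma gauss_le (x : ℝ) : gaussPDF x ≤ Real.exp (-x ^ 2 / 2) := by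
  unfold gaussPDF
  have h1 : 1 ≤ √(2 * π) := Real.one_le_sqrt.2 (by linarith [Real.pi_gt_three])
  have : (√(2 * π))⁻¹ ≤ 1 := inv_le_one_of_one_le₀ h1
  nlinarith [Real.exp_pos (-x ^ 2 / 2)]

theorem local_bounds (h : GoodDens ρ W) : ∃ C > 0, ∃ n0 : ℕ, 2 ≤ n0 ∧ ∀ n : ℕ, n0 ≤ n →
    (∀ x, rescaledConv ρ n x ≤ C) ∧
    (∀ x, |x| ≤ cutT n → |rescaledConv (trunc ρ n) n x - gaussPDF x| ≤
      C / √n * (1 + |x| ^ 3) * Real.exp (-x ^ 2 / 2)) ∧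
    (∀ x, cutT n < |x| → |rescaledConv (trunc ρ n) n x - gaussPDF x| ≤ C / n * Real.exp (-|x|)) ∧
    (∀ x, cutT n < |x| → gaussPDF x ≤ C / n * Real.exp (-|x|)) := by
  obtain ⟨C, hC, η, hη, n1, hn12, hs⟩ := star h
  obtain ⟨n2, hT⟩ := cutT_large (min η 1) (lt_min hη one_pos)
  obtain ⟨n3, hn3⟩ := exists_nat_gt ((1 / η) ^ 2)
  refine ⟨7 * C + 1, by positivity, max n1 (max n2 n3), hn12.trans (le_max_left _ _), ?_⟩
  intro n hn
  have hnn1 : n1 ≤ n := (le_max_left _ _).trans hn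
  have hnn2 : n2 ≤ n := (le_max_left _ _).trans ((le_max_right _ _).trans hn)
  have hnn3 : n3 ≤ n := (le_max_right _ _).trans ((le_max_right _ _).trans hn)
  have hn2 : 2 ≤ n := hn12.trans hnn1
  obtain ⟨hT2, hTe⟩ := hT n hnn2
  have hTsq := cutT_sq n (by omega)
  set T := cutT n with hTdef
  have hnR : (2 : ℝ) ≤ n := by exact_mod_cast hn2
  set σ := √(n : ℝ) with hσ
  have hσ1 : 1 ≤ σ := Real.one_le_sqrt.2 (by linarith)
  have hσn : σ * σ = n := Real.mul_self_sqrt (by positivity)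
  have hσ0 : 0 < σ := by linarith
  have hn0 : (0 : ℝ) < n := by linarith
  have hTη : (1 + T) * Real.exp T ≤ η * σ :=
    hTe.trans (mul_le_mul_of_nonneg_right (min_le_left _ _) hσ0.le)
  have hT1 : (1 + T) * Real.exp T ≤ σ :=
    hTe.trans ((mul_le_mul_of_nonneg_right (min_le_right _ _) hσ0.le).trans (by rw [one_mul]))
  have hstar : ∀ r : ℝ, |r| ≤ T → ∀ x, |rescaledConv (trunc ρ n) n x - gaussPDF x| ≤
      C / σ * (1 + |r| ^ 3) * Real.exp (r ^ 2 / 2 - r * x) := by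
    intro r hr
    have hm : (1 + |r|) * Real.exp |r| ≤ (1 + T) * Real.exp T := by gcongr
    exact hs n hnn1 _ r (trunc_adm h n (by omega) r (hm.trans hT1)) (hm.trans hTη)
      (trunc_decay h n (by omega) r (hm.trans hT1)) (trunc_cont h n hn2)
  have heT : Real.exp T ≤ σ := by nlinarith [Real.exp_pos T]
  have hT3 : 1 + T ^ 3 ≤ 7 * n := by
    have h1 := Real.pow_div_factorial_le_exp T (by linarith) 3
    norm_num [Nat.factorial] at h1
    have : σ ≤ n := by nlinarith
    linarith
  -- the common tail estimate
  have htail : ∀ x : ℝ, Real.exp (-(T ^ 2 / 2) + T - |x|) ≤ 1 / n * (1 / σ) * Real.exp (-|x|) := by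
    intro x
    have : Real.exp (-(T ^ 2 / 2) + T - |x|) = (Real.exp (T ^ 2 / 2))⁻¹ * Real.exp T * Real.exp (-|x|) := by
      rw [← Real.exp_neg, ← Real.exp_add, ← Real.exp_add]; congr 1
    rw [this, hTsq]
    refine mul_le_mul_of_nonneg_right ?_ (Real.exp_pos _).le
    calc ((n : ℝ) ^ 2)⁻¹ * Real.exp T ≤ ((n : ℝ) ^ 2)⁻¹ * σ := by gcongr
      _ = _ := by rw [← hσn]; field_simp
  refine ⟨?_, ?_, ?_, ?_⟩
  · intro x
    have hadm : Adm ρ ρ 0 σ := ⟨h.meas, h.pos, fun _ => le_rfl, fun _ _ => rfl, fun x _ => by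
      have := abs_nonneg x
      simp; linarith⟩
    have hcc : Continuous (iterConv ρ (n - 1)) := by
      rw [show n - 1 = (n - 2) + 1 by omega]
      exact iterConv_cont h.meas h.pos h.bdd h.int h.mass.le (S := ∅) countable_empty
        (fun x _ => h.cont.continuousAt) _
    have h1 := hs n hnn1 ρ 0 hadm (by
        have : 1 / η ≤ σ := by
          apply Real.le_sqrt_of_sq_le
          have : (n3 : ℝ) ≤ n := by exact_mod_cast hnn3
          linarith
        rw [div_le_iff₀ hη] at this
        simp; linarith) (fun t ht => by
        have h2 := lap_decay ρ h.int W h.decay (t / σ) (by positivity)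
        have e : (((0 : ℝ) : ℂ) + t * Complex.I) / ((σ : ℝ) : ℂ) = ((t / σ : ℝ) : ℂ) * Complex.I := by
          push_cast; ring
        rw [e]
        refine h2.trans ?_
        have hW := h.W0
        rw [abs_div, abs_of_pos hσ0, div_div_eq_mul_div]
        have : σ ≤ n := by nlinarith
        gcongr) hcc x
    simp only [abs_zero] at h1
    norm_num at h1
    have h2 := (abs_le.1 h1).2
    have h3 := gauss_le x
    have h4 : Real.exp (-x ^ 2 / 2) ≤ 1 := Real.exp_le_one_iff.2 (by nlinarith [sq_nonneg x])
    have h5 : C / σ ≤ C := div_le_self hC.le hσ1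
    linarith
  · intro x hx
    have h1 := hstar x hx x
    rw [show x ^ 2 / 2 - x * x = -x ^ 2 / 2 by ring] at h1
    refine h1.trans ?_
    have : C ≤ 7 * C + 1 := by linarith
    gcongr
  · intro x hx
    have hmain : |rescaledConv (trunc ρ n) n x - gaussPDF x| ≤
        C / σ * (1 + T ^ 3) * Real.exp (T ^ 2 / 2 - T * |x|) := by
      have hTa : |T| = T := abs_of_nonneg (by linarith)
      rcases le_total 0 x with hx0 | hx0
      · have := hstar T hTa.le x
        rw [hTa] at this
        rwa [abs_of_nonneg hx0]
      · have := hstar (-T) (by rw [abs_neg, hTa]) x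
        rw [abs_neg, hTa] at this
        rw [abs_of_nonpos hx0]
        convert this using 2
        ring_nf
    refine hmain.trans ?_
    have he : Real.exp (T ^ 2 / 2 - T * |x|) ≤ 1 / n * (1 / σ) * Real.exp (-|x|) := by
      refine (Real.exp_le_exp.2 ?_).trans (htail x)
      nlinarith
    calc C / σ * (1 + T ^ 3) * Real.exp (T ^ 2 / 2 - T * |x|) ≤
        C / σ * (7 * n) * (1 / n * (1 / σ) * Real.exp (-|x|)) := by gcongr
      _ = 7 * C / (σ * σ) * Real.exp (-|x|) := by field_simp
      _ ≤ _ := by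
        rw [hσn]
        have : 7 * C ≤ 7 * C + 1 := by linarith
        gcongr
  · intro x hx
    have he : Real.exp (-x ^ 2 / 2) ≤ 1 / n * (1 / σ) * Real.exp (-|x|) := by
      refine (Real.exp_le_exp.2 ?_).trans (htail x)
      rw [← sq_abs x]
      nlinarith
    refine (gauss_le x).trans (he.trans ?_)
    have h1 : 1 / σ ≤ 1 := (div_le_one hσ0).2 hσ1
    calc 1 / (n : ℝ) * (1 / σ) * Real.exp (-|x|) ≤ 1 / n * 1 * Real.exp (-|x|) := by gcongr
      _ = 1 / n * Real.exp (-|x|) := by ring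
      _ ≤ _ := by
        have : 1 ≤ 7 * C + 1 := by linarith
        gcongr

end


lemma elem1 (x : ℝ) : Real.exp (-(|x| / 2)) ≤ 9 * (1 + x ^ 2)⁻¹ := by
  rw [Real.exp_neg, ← one_div, ← div_eq_mul_inv, div_le_div_iff₀ (Real.exp_pos _) (by positivity)]
  have h1 := Real.pow_div_factorial_le_exp (|x| / 2) (by positivity) 2
  have h2 : 1 ≤ Real.exp (|x| / 2) := Real.one_le_exp (by positivity)
  norm_num [Nat.factorial] at h1
  have h3 : (|x| / 2) ^ 2 / 2 = x ^ 2 / 8 := by rw [div_pow, sq_abs]; ring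
  nlinarith

lemma elem2 (x : ℝ) : (1 + |x| ^ 3) ^ 2 * Real.exp (-x ^ 2 / 2) ≤
    49 * Real.exp (25 / 8) * Real.exp (-(|x| / 2)) := by
  have h1 := Real.pow_div_factorial_le_exp (|x|) (by positivity) 3
  have h2 : 1 ≤ Real.exp (|x|) := Real.one_le_exp (by positivity)
  norm_num [Nat.factorial] at h1
  have h3 : (1 + |x| ^ 3) ≤ 7 * Real.exp |x| := by linarith
  have h4 : Real.exp |x| ^ 2 * Real.exp (-x ^ 2 / 2) ≤
      Real.exp (25 / 8) * Real.exp (-(|x| / 2)) := by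
    rw [← Real.exp_nat_mul, ← Real.exp_add, ← Real.exp_add]
    apply Real.exp_le_exp.2
    rw [← sq_abs x]; push_cast
    nlinarith [sq_nonneg (|x| - 5 / 2)]
  calc (1 + |x| ^ 3) ^ 2 * Real.exp (-x ^ 2 / 2) ≤ (7 * Real.exp |x|) ^ 2 * Real.exp (-x ^ 2 / 2) := by
        gcongr
    _ = 49 * (Real.exp |x| ^ 2 * Real.exp (-x ^ 2 / 2)) := by ring
    _ ≤ 49 * (Real.exp (25 / 8) * Real.exp (-(|x| / 2))) := by gcongr
    _ = _ := by ring

lemma elem3 (x : ℝ) : x ^ 2 / 2 * Real.exp (-|x|) ≤ 4 * Real.exp (-(|x| / 2)) := by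
  have h1 := Real.pow_div_factorial_le_exp (|x| / 2) (by positivity) 2
  norm_num [Nat.factorial] at h1
  have h3 : (|x| / 2) ^ 2 / 2 = x ^ 2 / 8 := by rw [div_pow, sq_abs]; ring
  calc x ^ 2 / 2 * Real.exp (-|x|) ≤ (4 * Real.exp (|x| / 2)) * Real.exp (-|x|) := by
        gcongr; linarith
    _ = _ := by rw [mul_assoc, ← Real.exp_add]; congr 2; ring

lemma gauss_inv (x : ℝ) : (gaussPDF x)⁻¹ ≤ 3 * Real.exp (x ^ 2 / 2) := by
  unfold gaussPDF
  rw [mul_inv, inv_inv, ← Real.exp_neg, show -(-x ^ 2 / 2) = x ^ 2 / 2 by ring]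
  gcongr
  exact Real.sqrt_le_iff.2 ⟨by norm_num, by linarith [Real.pi_lt_four]⟩

lemma ent_point {a b p g L : ℝ} (hg : 0 < g) (ha : 0 ≤ a) (hb : 0 ≤ b) (hp : p = a + b)
    (hL : 0 < p → Real.log (p / g) ≤ L) :
    p * Real.log (p / g) ≤ (a - g) ^ 2 / g + b * L + p - g := by
  have e : (a - g) ^ 2 / g = a ^ 2 / g - 2 * a + g := by field_simp; ring
  rcases (add_nonneg ha hb).eq_or_lt with h0 | h0
  · have hp0 : p = 0 := by linarith
    have ha0 : a = 0 := by linarith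
    have hb0 : b = 0 := by linarith
    rw [e, hp0, ha0, hb0]; simp
  · rw [← hp] at h0
    have hL := hL h0
    have h1 : b * Real.log (p / g) ≤ b * L := mul_le_mul_of_nonneg_left hL hb
    have h2 : a * Real.log (p / g) ≤ a ^ 2 / g - 2 * a + p := by
      rcases ha.eq_or_lt with h3 | h3
      · rw [← h3]; simp; linarith
      · have h4 : p / g = (a / g) * (p / a) := by field_simp
        have h5 := Real.log_le_sub_one_of_pos (div_pos h3 hg)
        have h6 := Real.log_le_sub_one_of_pos (div_pos h0 h3)
        rw [h4, Real.log_mul (by positivity) (by positivity)]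
        calc a * (Real.log (a / g) + Real.log (p / a)) ≤ a * ((a / g - 1) + (p / a - 1)) := by
              gcongr
          _ = _ := by field_simp; ring
    rw [e]
    have : p * Real.log (p / g) = a * Real.log (p / g) + b * Real.log (p / g) := by rw [hp]; ring
    linarith

lemma ent_point2 {a b p g L : ℝ} (ha : 0 ≤ a) (hb : 0 ≤ b) (hp : p = a + b)
    (hL0 : 0 ≤ L) (hL : 0 < p → Real.log (p / g) ≤ L) :
    p * Real.log (p / g) ≤ a * L + g + b * L + p - g := by
  have hp0 : 0 ≤ p := by linarith
  rcases hp0.eq_or_lt with h0 | h0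
  · have h1 := mul_nonneg ha hL0
    have h2 := mul_nonneg hb hL0
    rw [← h0, zero_mul]; linarith
  · have := mul_le_mul_of_nonneg_left (hL h0) hp0
    rw [hp] at this ⊢
    nlinarith

section
variable {ρ : ℝ → ℝ} {W : ℝ}

lemma resc_moments {f : ℝ → ℝ} (f0 : Integrable f) (f1 : Integrable fun x => x * f x)
    (f2 : Integrable fun x => x ^ 2 * f x) (n : ℕ) (hn : 1 ≤ n) :
    Integrable (rescaledConv f n) ∧ Integrable (fun x => x ^ 2 * rescaledConv f n x) ∧
    ∫ x, rescaledConv f n x = (∫ x, f x) ^ n ∧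
    ∫ x, x ^ 2 * rescaledConv f n x = (∫ x, f x) ^ (n - 1) * (∫ x, x ^ 2 * f x)
      + ((n - 1 : ℕ) : ℝ) * (∫ x, f x) ^ (n - 1 - 1) * (∫ x, x * f x) ^ 2 := by
  obtain ⟨⟨i0, -, i2⟩, j0, -, j2⟩ := iter_moments f0 f1 f2 (n - 1)
  have hσ : 0 < √(n : ℝ) := Real.sqrt_pos.2 (by exact_mod_cast hn)
  have hσ2 : √(n : ℝ) * √n = n := Real.mul_self_sqrt (by positivity)
  have e0 : rescaledConv f n = fun x => √n * iterConv f (n - 1) (√n * x) := rfl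
  have e2 : (fun x => x ^ 2 * rescaledConv f n x) = fun x => (√n)⁻¹ *
      ((fun y => y ^ 2 * iterConv f (n - 1) y) (√n * x)) := by
    ext x; simp only [rescaledConv]; field_simp
  have hcast : (((n - 1 : ℕ) : ℝ) + 1) = n := by
    rw [← Nat.cast_succ]; congr 1; omega
  refine ⟨?_, ?_, ?_, ?_⟩
  · rw [e0]; exact (i0.comp_mul_left' hσ.ne').const_mul _
  · rw [e2]; exact (i2.comp_mul_left' hσ.ne').const_mul _
  · rw [e0, integral_const_mul, Measure.integral_comp_mul_left (iterConv f (n - 1)),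
      abs_of_pos (by positivity), smul_eq_mul, ← mul_assoc, mul_inv_cancel₀ hσ.ne', one_mul, j0]
    congr 1; omega
  · rw [e2, integral_const_mul,
      Measure.integral_comp_mul_left (fun y => y ^ 2 * iterConv f (n - 1) y),
      abs_of_pos (by positivity), smul_eq_mul, ← mul_assoc, ← mul_inv, hσ2, j2, hcast]
    have : (n : ℝ) ≠ 0 := by exact_mod_cast (by omega : n ≠ 0)
    field_simp

lemma trunc_moments (h : GoodDens ρ W) (n : ℕ) (hn : 1 ≤ n) :
    Integrable (rescaledConv ρ n) ∧ Integrable (rescaledConv (trunc ρ n) n) ∧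
    Integrable (fun x => x ^ 2 * rescaledConv ρ n x) ∧
    Integrable (fun x => x ^ 2 * rescaledConv (trunc ρ n) n x) ∧
    ∫ x, rescaledConv ρ n x = 1 ∧ ∫ x, x ^ 2 * rescaledConv ρ n x = 1 ∧
    1 - (∫ x, x ^ 4 * ρ x) / n ≤ ∫ x, rescaledConv (trunc ρ n) n x ∧
    1 - 2 * (∫ x, x ^ 4 * ρ x) / n ≤ ∫ x, x ^ 2 * rescaledConv (trunc ρ n) n x := by
  have t0 := trunc_int h n
  have et : ∀ k : ℕ, (fun x => x ^ k * trunc ρ n x) =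
      (Icc (-√(n : ℝ)) (√(n : ℝ))).indicator (fun x => x ^ k * ρ x) := by
    intro k; ext x
    by_cases hx : x ∈ Icc (-√(n : ℝ)) (√(n : ℝ)) <;> simp only [trunc, hx, indicator_of_mem,
      indicator_of_notMem, not_false_eq_true, mul_zero]
  have t2 : Integrable fun x => x ^ 2 * trunc ρ n x := by
    rw [et]; exact h.i2.indicator measurableSet_Icc
  have t1 : Integrable fun x => x * trunc ρ n x := by
    have := et 1
    simp only [pow_one] at this
    rw [this]; exact h.i1.indicator measurableSet_Icc
  obtain ⟨a1, a2, a3, a4⟩ := resc_moments t0 t1 t2 n hn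
  obtain ⟨p1, p2, p3, p4⟩ := resc_moments h.int h.i1 h.i2 n hn
  rw [h.mass] at p3 p4
  rw [h.var, h.mean] at p4
  simp only [one_pow, mul_one, ne_eq, OfNat.ofNat_ne_zero, not_false_eq_true, zero_pow, mul_zero,
    add_zero] at p3 p4
  set m4 := ∫ x, x ^ 4 * ρ x with hm4
  set μ0 := ∫ x, trunc ρ n x with hμ0
  set μ2 := ∫ x, x ^ 2 * trunc ρ n x with hμ2
  have hnR : (0 : ℝ) < n := by exact_mod_cast hn
  have hm40 : 0 ≤ m4 := integral_nonneg fun x => mul_nonneg (by positivity) (h.pos x)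
  have hout : ∀ x, x ∉ Icc (-√(n : ℝ)) (√(n : ℝ)) → (n : ℝ) ≤ x ^ 2 := by
    intro x hx
    have : √(n : ℝ) < |x| := by
      by_contra hc; push Not at hc; exact hx (abs_le.1 hc)
    have h2 := Real.lt_sq_of_sqrt_lt this
    rw [sq_abs] at h2; exact h2.le
  have hμ0' : 1 - μ0 ≤ m4 / n ^ 2 := by
    rw [← h.mass, hμ0, ← integral_sub h.int t0, hm4, ← integral_div]
    refine integral_mono (h.int.sub t0) (h.i4.div_const _) fun x => ?_
    by_cases hx : x ∈ Icc (-√(n : ℝ)) (√(n : ℝ))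
    · simp only [trunc, hx, indicator_of_mem, sub_self]
      have := h.pos x
      positivity
    · simp only [trunc, hx, indicator_of_notMem, not_false_eq_true, sub_zero]
      rw [le_div_iff₀ (by positivity), mul_comm]
      refine mul_le_mul_of_nonneg_right ?_ (h.pos x)
      nlinarith [hout x hx]
  have hμ2' : 1 - μ2 ≤ m4 / n := by
    rw [← h.var, hμ2, ← integral_sub h.i2 t2, hm4, ← integral_div]
    refine integral_mono (h.i2.sub t2) (h.i4.div_const _) fun x => ?_
    by_cases hx : x ∈ Icc (-√(n : ℝ)) (√(n : ℝ))
    · simp only [trunc, hx, indicator_of_mem, sub_self]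
      have := h.pos x
      positivity
    · simp only [trunc, hx, indicator_of_notMem, not_false_eq_true, sub_zero, mul_zero]
      rw [le_div_iff₀ (by positivity)]
      have := mul_le_mul_of_nonneg_left (hout x hx) (mul_nonneg (sq_nonneg x) (h.pos x))
      calc _ ≤ _ := this
        _ = _ := by ring
  have hμ01 : μ0 ≤ 1 := trunc_mass h n
  have hμ00 : 0 ≤ μ0 := integral_nonneg (trunc_pos h n)
  have hμ21 : μ2 ≤ 1 := by
    rw [← h.var]
    exact integral_mono t2 h.i2 fun x => mul_le_mul_of_nonneg_left (trunc_le h n x) (sq_nonneg x)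
  have hpow : 1 - m4 / n ≤ μ0 ^ n := by
    have h1 := one_add_mul_le_pow (a := μ0 - 1) (by linarith) n
    rw [add_sub_cancel] at h1
    have h2 : (n : ℝ) * (m4 / n ^ 2) = m4 / n := by field_simp
    nlinarith
  refine ⟨p1, a1, p2, a2, p3, p4, ?_, ?_⟩
  · rw [a3]; exact hpow
  · rw [a4]
    have h1 : μ0 ^ n ≤ μ0 ^ (n - 1) := pow_le_pow_of_le_one hμ00 hμ01 (Nat.sub_le _ _)
    have h2 : μ0 ^ (n - 1) ≤ 1 := pow_le_one₀ hμ00 hμ01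
    have h3 : 0 ≤ ((n - 1 : ℕ) : ℝ) * μ0 ^ (n - 1 - 1) * (∫ x, x * trunc ρ n x) ^ 2 := by positivity
    have h4 : 2 * m4 / n = m4 / n + m4 / n := by ring
    nlinarith [mul_nonneg (sub_nonneg.2 h2) (sub_nonneg.2 hμ21)]

theorem main_bound (h : GoodDens ρ W) : ∃ c : ℝ, 0 ≤ c ∧ ∃ n0 : ℕ, ∀ n : ℕ, n0 ≤ n →
    relEntropy (rescaledConv ρ n) ≤ c / n ∧
    ∫ x, |rescaledConv ρ n x - gaussPDF x| ≤ c / √n := by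
  obtain ⟨C, hC, n0, hn02, hb⟩ := local_bounds h
  set m4 := ∫ x, x ^ 4 * ρ x with hm4
  have hm40 : 0 ≤ m4 := integral_nonneg fun x => mul_nonneg (by positivity) (h.pos x)
  set E := 49 * Real.exp (25 / 8) with hE
  have hE0 : 0 < E := by positivity
  set K := 9 * (3 * C ^ 2 * E + (2 * C * (3 * C + 4) + C)) with hK
  have hK0 : 0 < K := by positivity
  set K' := 9 * (C * E + C) with hK'
  have hK'0 : 0 < K' := by positivity
  refine ⟨(K * π + (3 * C + 1) * m4) + (K' * π + m4), by positivity, n0, fun n hn => ?_⟩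
  obtain ⟨hpC, hin, hout, hgout⟩ := hb n hn
  have hn2 : 2 ≤ n := hn02.trans hn
  have hnR : (2 : ℝ) ≤ n := by exact_mod_cast hn2
  have hn0 : (0 : ℝ) < n := by linarith
  obtain ⟨p1, a1, p2, a2, p3, p4, a3, a4⟩ := trunc_moments h n (by omega)
  rw [← hm4] at a3 a4
  set p := rescaledConv ρ n with hp
  set a := rescaledConv (trunc ρ n) n with ha
  set T := cutT n with hT
  set σ := √(n : ℝ) with hσ
  have hσ1 : 1 ≤ σ := Real.one_le_sqrt.2 (by linarith)
  have hσn : σ * σ = n := Real.mul_self_sqrt (by positivity)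
  have hσ0 : 0 < σ := by linarith
  have hσlen : σ ≤ n := by nlinarith
  have ha0 : ∀ x, 0 ≤ a x := fun x => mul_nonneg hσ0.le (iterConv_nonneg (trunc_pos h n) _ _)
  have hap : ∀ x, a x ≤ p x := fun x => mul_le_mul_of_nonneg_left
    (iterConv_mono (trunc_meas h n) (trunc_pos h n) h.meas (trunc_le h n) h.bdd h.int h.mass.le _ _)
    hσ0.le
  set b : ℝ → ℝ := fun x => p x - a x with hbdef
  have hb0 : ∀ x, 0 ≤ b x := fun x => sub_nonneg.2 (hap x)
  have hpab : ∀ x, p x = a x + b x := fun x => by simp [hbdef]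
  have bi : Integrable b := p1.sub a1
  have bi2 : Integrable fun x => x ^ 2 * b x :=
    (p2.sub a2).congr (Filter.Eventually.of_forall fun x => by simp [hbdef]; ring)
  have bI : ∫ x, b x ≤ m4 / n := by
    rw [integral_sub p1 a1, p3]; linarith
  have bI2 : ∫ x, x ^ 2 * b x ≤ 2 * m4 / n := by
    have : ∫ x, x ^ 2 * b x = ∫ x, (x ^ 2 * p x - x ^ 2 * a x) := by
      congr 1; ext x; simp [hbdef]; ring
    rw [this, integral_sub p2 a2, p4]; linarith
  have hL : ∀ x, 0 < p x → Real.log (p x / gaussPDF x) ≤ 3 * C + x ^ 2 / 2 := by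
    intro x hx
    have hg := gauss_pos x
    have h1 : p x / gaussPDF x ≤ (3 * C) * Real.exp (x ^ 2 / 2) := by
      rw [div_eq_mul_inv]
      calc p x * (gaussPDF x)⁻¹ ≤ C * (3 * Real.exp (x ^ 2 / 2)) := by
            gcongr
            · exact hpC x
            · exact gauss_inv x
        _ = _ := by ring
    have h2 := Real.log_le_log (div_pos hx hg) h1
    rw [Real.log_mul (by positivity) (by positivity), Real.log_exp] at h2
    have h3 := Real.log_le_sub_one_of_pos (show 0 < 3 * C by positivity)
    linarith
  have hIntg := integrable_inv_one_add_sq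
  constructor
  · -- entropy
    set U : ℝ → ℝ := fun x => (K / n * (1 + x ^ 2)⁻¹ + (3 * C * b x + 1 / 2 * (x ^ 2 * b x)))
      + (p x - gaussPDF x) with hU
    have hU1 : Integrable fun x : ℝ => K / n * (1 + x ^ 2)⁻¹ := hIntg.const_mul _
    have hU2 : Integrable fun x : ℝ => 3 * C * b x := bi.const_mul _
    have hU3 : Integrable fun x : ℝ => 1 / 2 * (x ^ 2 * b x) := bi2.const_mul _
    have hU23 : Integrable fun x : ℝ => 3 * C * b x + 1 / 2 * (x ^ 2 * b x) := hU2.add hU3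
    have hU123 : Integrable fun x : ℝ => K / n * (1 + x ^ 2)⁻¹ +
      (3 * C * b x + 1 / 2 * (x ^ 2 * b x)) := hU1.add hU23
    have hU4 : Integrable fun x : ℝ => p x - gaussPDF x := p1.sub gauss_int
    have hUi : Integrable U := hU123.add hU4
    have hUI : ∫ x, U x ≤ (K * π + (3 * C + 1) * m4) / n := by
      rw [hU, integral_add hU123 hU4, integral_add hU1 hU23, integral_add hU2 hU3,
        integral_sub p1 gauss_int, p3, gauss_mass, integral_const_mul, integral_const_mul,
        integral_const_mul, integral_univ_inv_one_add_sq]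
      have h1 : 3 * C * ∫ x, b x ≤ 3 * C * (m4 / n) := by gcongr
      have h2 : (K * π + (3 * C + 1) * m4) / n = K / n * π + (3 * C * (m4 / n) +
        1 / 2 * (2 * m4 / n)) := by ring
      rw [h2]
      linarith
    have hpt : ∀ x, p x * Real.log (p x / gaussPDF x) ≤ U x := by
      intro x
      have hg := gauss_pos x
      have e1 := elem1 x
      have ex := Real.exp_pos (-(|x| / 2))
      rcases le_or_gt |x| T with hx | hx
      · have h1 := ent_point hg (ha0 x) (hb0 x) (hpab x) (hL x)
        have h2 : (a x - gaussPDF x) ^ 2 / gaussPDF x ≤ K / n * (1 + x ^ 2)⁻¹ := by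
          rw [div_eq_mul_inv, ← sq_abs (a x - gaussPDF x)]
          calc |a x - gaussPDF x| ^ 2 * (gaussPDF x)⁻¹ ≤
              (C / σ * (1 + |x| ^ 3) * Real.exp (-x ^ 2 / 2)) ^ 2 * (3 * Real.exp (x ^ 2 / 2)) := by
                gcongr
                · exact hin x hx
                · exact gauss_inv x
            _ = 3 * C ^ 2 / (σ * σ) * ((1 + |x| ^ 3) ^ 2 * (Real.exp (-x ^ 2 / 2) *
                (Real.exp (-x ^ 2 / 2) * Real.exp (x ^ 2 / 2)))) := by field_simp
            _ = 3 * C ^ 2 / n * ((1 + |x| ^ 3) ^ 2 * Real.exp (-x ^ 2 / 2)) := by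
                rw [hσn, ← Real.exp_add (-x ^ 2 / 2) (x ^ 2 / 2),
                  show -x ^ 2 / 2 + x ^ 2 / 2 = 0 by ring, Real.exp_zero, mul_one]
            _ ≤ 3 * C ^ 2 / n * (E * (9 * (1 + x ^ 2)⁻¹)) := by
                refine mul_le_mul_of_nonneg_left ?_ (by positivity)
                exact (elem2 x).trans (mul_le_mul_of_nonneg_left e1 hE0.le)
            _ = 9 * (3 * C ^ 2 * E) / n * (1 + x ^ 2)⁻¹ := by ring
            _ ≤ _ := by
                have : 9 * (3 * C ^ 2 * E) ≤ K := by
                  have : 0 ≤ 2 * C * (3 * C + 4) + C := by positivity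
                  rw [hK]; linarith
                gcongr
        simp only [hU]
        linarith
      · have h1 := ent_point2 (g := gaussPDF x) (ha0 x) (hb0 x) (hpab x) (by positivity) (hL x)
        have h3 : a x ≤ 2 * C / n * Real.exp (-|x|) := by
          have := (abs_le.1 (hout x hx)).2
          have := hgout x hx
          have e : 2 * C / n * Real.exp (-|x|) = C / n * Real.exp (-|x|) + C / n * Real.exp (-|x|) := by
            ring
          linarith
        have e3 := elem3 x
        have e4 : Real.exp (-|x|) ≤ Real.exp (-(|x| / 2)) :=
          Real.exp_le_exp.2 (by have := abs_nonneg x; linarith)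
        have h2 : a x * (3 * C + x ^ 2 / 2) + gaussPDF x ≤ K / n * (1 + x ^ 2)⁻¹ := by
          calc a x * (3 * C + x ^ 2 / 2) + gaussPDF x ≤
              2 * C / n * Real.exp (-|x|) * (3 * C + x ^ 2 / 2) + C / n * Real.exp (-|x|) := by
                gcongr; exact hgout x hx
            _ = 2 * C / n * (3 * C * Real.exp (-|x|) + x ^ 2 / 2 * Real.exp (-|x|))
                  + C / n * Real.exp (-|x|) := by ring
            _ ≤ 2 * C / n * (3 * C * Real.exp (-(|x| / 2)) + 4 * Real.exp (-(|x| / 2)))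
                  + C / n * Real.exp (-(|x| / 2)) := by gcongr
            _ = (2 * C * (3 * C + 4) + C) / n * Real.exp (-(|x| / 2)) := by ring
            _ ≤ (2 * C * (3 * C + 4) + C) / n * (9 * (1 + x ^ 2)⁻¹) := by gcongr
            _ = 9 * (2 * C * (3 * C + 4) + C) / n * (1 + x ^ 2)⁻¹ := by ring
            _ ≤ _ := by
                have : 9 * (2 * C * (3 * C + 4) + C) ≤ K := by
                  have : 0 ≤ 3 * C ^ 2 * E := by positivity
                  rw [hK]; linarith
                gcongr
        simp only [hU]
        linarith
    have hfin : (K * π + (3 * C + 1) * m4) / n ≤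
        (K * π + (3 * C + 1) * m4 + (K' * π + m4)) / n := by
      have : 0 ≤ K' * π + m4 := by positivity
      refine div_le_div_of_nonneg_right (by linarith) hn0.le
    unfold relEntropy
    by_cases hi : Integrable fun x => p x * Real.log (p x / gaussPDF x)
    · exact ((integral_mono hi hUi hpt).trans hUI).trans hfin
    · rw [integral_undef hi]; positivity
  · have hV1 : Integrable fun x : ℝ => K' / σ * (1 + x ^ 2)⁻¹ := hIntg.const_mul _
    have hpt : ∀ x, |p x - gaussPDF x| ≤ K' / σ * (1 + x ^ 2)⁻¹ + b x := by
      intro x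
      have e1 := elem1 x
      have h0 : |p x - gaussPDF x| ≤ |a x - gaussPDF x| + b x := by
        have : p x - gaussPDF x = (a x - gaussPDF x) + b x := by rw [hpab x]; ring
        rw [this]
        refine (abs_add_le _ _).trans ?_
        rw [abs_of_nonneg (hb0 x)]
      have h1 : |a x - gaussPDF x| ≤ K' / σ * (1 + x ^ 2)⁻¹ := by
        rcases le_or_gt |x| T with hx | hx
        · have hq : 1 ≤ 1 + |x| ^ 3 := by
            have : 0 ≤ |x| ^ 3 := by positivity
            linarith
          calc _ ≤ _ := hin x hx
            _ ≤ C / σ * (1 + |x| ^ 3) ^ 2 * Real.exp (-x ^ 2 / 2) := by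
                gcongr; exact le_self_pow₀ hq two_ne_zero
            _ = C / σ * ((1 + |x| ^ 3) ^ 2 * Real.exp (-x ^ 2 / 2)) := by ring
            _ ≤ C / σ * (E * (9 * (1 + x ^ 2)⁻¹)) := by
                refine mul_le_mul_of_nonneg_left ?_ (by positivity)
                exact (elem2 x).trans (mul_le_mul_of_nonneg_left e1 hE0.le)
            _ = 9 * (C * E) / σ * (1 + x ^ 2)⁻¹ := by ring
            _ ≤ _ := by
                have : 9 * (C * E) ≤ K' := by rw [hK']; linarith
                gcongr
        · have e4 : Real.exp (-|x|) ≤ Real.exp (-(|x| / 2)) :=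
            Real.exp_le_exp.2 (by have := abs_nonneg x; linarith)
          calc _ ≤ _ := hout x hx
            _ ≤ C / σ * (9 * (1 + x ^ 2)⁻¹) := by
                gcongr
                exact e4.trans e1
            _ = 9 * C / σ * (1 + x ^ 2)⁻¹ := by ring
            _ ≤ _ := by
                have : 9 * C ≤ K' := by
                  have : 0 ≤ C * E := by positivity
                  rw [hK']; linarith
                gcongr
      linarith
    have h1 : ∫ x, |p x - gaussPDF x| ≤ ∫ x, (K' / σ * (1 + x ^ 2)⁻¹ + b x) :=
      integral_mono (p1.sub gauss_int).abs (hV1.add bi) hpt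
    rw [integral_add hV1 bi, integral_const_mul, integral_univ_inv_one_add_sq] at h1
    have h2 : m4 / n ≤ m4 / σ := by gcongr
    have h3 : (K * π + (3 * C + 1) * m4 + (K' * π + m4)) / σ =
      (K * π + (3 * C + 1) * m4) / σ + (K' / σ * π + m4 / σ) := by ring
    have h4 : 0 ≤ (K * π + (3 * C + 1) * m4) / σ := by positivity
    linarith

end


lemma bound_all (u : ℕ → ℝ) (N : ℕ) (c : ℝ) (hu : ∀ k, N ≤ k → u k ≤ c) : ∃ c', ∀ k, u k ≤ c' := by
  refine ⟨|c| + ∑ k ∈ Finset.range N, |u k|, fun k => ?_⟩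
  have h0 : 0 ≤ ∑ k ∈ Finset.range N, |u k| := Finset.sum_nonneg fun _ _ => abs_nonneg _
  rcases le_or_gt N k with hk | hk
  · have := hu k hk
    have := le_abs_self c
    linarith
  · have h1 := Finset.single_le_sum (f := fun k => |u k|) (fun i _ => abs_nonneg (u i))
      (Finset.mem_range.2 hk)
    have h2 := le_abs_self (u k)
    have h3 := abs_nonneg c
    linarith

/-- Optimal rate of convergence in the entropic CLT: if `ρ` is a
probability density with mean zero, unit variance, finite Fisher information and
finite fourth moment, then `D(ρ_N) ≤ c/N` for `N = 2ⁿ`; in particular `ρ_N → g`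
in relative entropy, and in `L¹` at the optimal rate `N^{-1/2}`. -/
theorem optimal_entropy_convergence (ρ : ℝ → ℝ)
    (hmeas : Measurable ρ) (hpos : ∀ x, 0 ≤ ρ x)
    (hmass : ∫ x, ρ x = 1)
    (hmean : ∫ x, x * ρ x = 0) (hvar : ∫ x, x ^ 2 * ρ x = 1)
    (hdiff : Differentiable ℝ fun x => Real.sqrt (ρ x))
    (hFisher : Integrable fun x => (deriv (fun y => Real.sqrt (ρ y)) x) ^ 2)
    (hmom4 : Integrable fun x => x ^ 4 * ρ x) :
    ∃ c : ℝ, ∀ n : ℕ,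
      relEntropy (rescaledConv ρ (2 ^ n)) ≤ c / 2 ^ n ∧
      ∫ x, |rescaledConv ρ (2 ^ n) x - gaussPDF x| ≤ c / Real.sqrt (2 ^ n) := by
  have i0 : Integrable ρ := by
    by_contra hc; rw [integral_undef hc] at hmass; norm_num at hmass
  have i2 : Integrable fun x => x ^ 2 * ρ x := by
    by_contra hc; rw [integral_undef hc] at hvar; norm_num at hvar
  have i1 : Integrable fun x => x * ρ x := by
    refine (i0.add i2).mono' (measurable_id.mul hmeas).aestronglyMeasurable
      (Filter.Eventually.of_forall fun x => ?_)
    rw [norm_mul, Real.norm_of_nonneg (hpos x), Real.norm_eq_abs]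
    have h1 : |x| ≤ 1 + x ^ 2 := by rw [← sq_abs]; nlinarith [sq_nonneg (|x| - 1)]
    calc |x| * ρ x ≤ (1 + x ^ 2) * ρ x := mul_le_mul_of_nonneg_right h1 (hpos x)
      _ = _ := by simp only [Pi.add_apply]; ring
  obtain ⟨hc, W, hW, hbd, hdec⟩ := dens_basic ρ hpos i0 hdiff hFisher
  have hG : GoodDens ρ W := ⟨hmeas, hpos, i0, hmass, hmean, hvar, i1, i2, hmom4, hW, hc, hbd, hdec⟩
  obtain ⟨c, hc0, n0, hmain⟩ := main_bound hG
  have hlt : ∀ k, n0 ≤ k → n0 ≤ 2 ^ k := fun k hk => hk.trans Nat.lt_two_pow_self.le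
  obtain ⟨c1, h1⟩ := bound_all (fun k => relEntropy (rescaledConv ρ (2 ^ k)) * 2 ^ k) n0 c
    (fun k hk => by
      have := (hmain (2 ^ k) (hlt k hk)).1
      push_cast at this
      rwa [le_div_iff₀ (by positivity)] at this)
  obtain ⟨c2, h2⟩ := bound_all (fun k => (∫ x, |rescaledConv ρ (2 ^ k) x - gaussPDF x|) *
    Real.sqrt (2 ^ k)) n0 c (fun k hk => by
      have := (hmain (2 ^ k) (hlt k hk)).2
      push_cast at this
      rwa [le_div_iff₀ (by positivity)] at this)
  refine ⟨max c1 c2, fun n => ⟨?_, ?_⟩⟩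
  · rw [le_div_iff₀ (by positivity)]; exact (h1 n).trans (le_max_left _ _)
  · rw [le_div_iff₀ (by positivity)]; exact (h2 n).trans (le_max_right _ _)
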